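/- Let N be a nonnegative integer and let η ∈ (ℝ_N ∪ 𝕀_N) with η ≠ 0. Then C^{−1}K_v is the reproducing kernel of Θ_N with respect to the Sklyanin pairing: for every f ∈ Θ_N and every v ∈ ℂ, ⟨f, K_v⟩ = C·f(v), where C = 2η p^{3/8} / (θ(2(N+1)η)·(p;p)_∞³). -/

import Mathlib

noncomputable section
open Complex MeasureTheory

def cπ : ℂ := Real.pi

/-- Jacobi's first theta function θ₁(x|τ). -/
def θf (τ x : ℂ) : ℂ :=
  I * ∑' n : ℤ, (-1 : ℂ) ^ n *
    Complex.exp (cπ * I * τ * ((n : ℂ) - 1/2)^2 + cπ * I * (2*(n : ℂ) - 1) * x)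

/-- The space Θ_N of even theta functions of order 2N. -/
def ThetaSp (τ : ℂ) (N : ℕ) (f : ℂ → ℂ) : Prop :=
  Differentiable ℂ f ∧ (∀ x, f (x + 1) = f x) ∧
  (∀ x, f (x + τ) = Complex.exp (-2*cπ*I*N*(2*x + τ)) * f x) ∧
  (∀ x, f (-x) = f x)

/-- Sklyanin's weight function M(u,v). -/
def Mw (τ η : ℂ) (N : ℕ) (u v : ℂ) : ℂ :=
  θf τ (2*u) * θf τ (2*v) /
    (Complex.exp (2*cπ*I*u*(N+2)) *
      ∏ k ∈ Finset.range (N+2),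
        (θf τ (u + v + (2*(k:ℂ) - N - 1)*η + 1/2 + τ/2) *
         θf τ (u - v + (2*(k:ℂ) - N - 1)*η + 1/2 + τ/2)))

/-- Sklyanin's invariant pairing, with τ = t * I. -/
def pairing (τ η : ℂ) (t : ℝ) (N : ℕ) (f g : ℂ → ℂ) : ℂ :=
  ∫ y in (0:ℝ)..t, ∫ x in (0:ℝ)..(1:ℝ),
    f (x + y*I) * (starRingEnd ℂ) (g (x + y*I)) *
      Mw τ η N (x + y*I) ((starRingEnd ℂ) (x + y*I))

/-- The numerator defining the difference operator Δ(a). -/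
def ΔRHS (τ η : ℂ) (N : ℕ) (a₁ a₂ a₃ a₄ : ℂ) (f : ℂ → ℂ) (x : ℂ) : ℂ :=
  θf τ (x + a₁ - N*η/2) * θf τ (x + a₂ - N*η/2) * θf τ (x + a₃ - N*η/2) *
    θf τ (x + a₄ - N*η/2) * f (x + η)
  - θf τ (x - a₁ + N*η/2) * θf τ (x - a₂ + N*η/2) * θf τ (x - a₃ + N*η/2) *
    θf τ (x - a₄ + N*η/2) * f (x - η)

/-- The involution σ on Θ_N. -/
def σop (τ : ℂ) (N : ℕ) (f : ℂ → ℂ) (x : ℂ) : ℂ :=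
  Complex.exp (2*cπ*I*N*(1/4 + τ/4 + x)) * f (x + 1/2 + τ/2)

/-- q-Pochhammer infinite product (a;p)_∞. -/
def qPoch (a p : ℂ) : ℂ := ∏' j : ℕ, (1 - a * p^j)

/-- The constant C of Theorem 3.2. -/
def Cconst (τ η : ℂ) (N : ℕ) : ℂ :=
  2*η * Complex.exp (2*cπ*I*τ*(3/8)) /
    (θf τ (2*(N+1)*η) *
      (qPoch (Complex.exp (2*cπ*I*τ)) (Complex.exp (2*cπ*I*τ)))^3)

/-- The kernel K(u,w). -/
def Kk (τ η : ℂ) (N : ℕ) (u w : ℂ) : ℂ :=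
  Complex.exp (2*cπ*I*u*(N:ℂ)) *
  ∏ k ∈ Finset.range N,
    (θf τ (u + w + (2*(k:ℂ) - N + 1)*η + 1/2 + τ/2) *
     θf τ (u - w + (2*(k:ℂ) - N + 1)*η + 1/2 + τ/2))

/-- The basis functions e_k^N(x;a,b). -/
def ekN (τ η : ℂ) (N k : ℕ) (a b : ℂ) (x : ℂ) : ℂ :=
  (∏ j ∈ Finset.range k, (θf τ (a + x + 2*(j:ℂ)*η) * θf τ (a - x + 2*(j:ℂ)*η))) *
  (∏ j ∈ Finset.range (N - k), (θf τ (b + x + 2*(j:ℂ)*η) * θf τ (b - x + 2*(j:ℂ)*η)))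

/-- Elliptic number [x] = θ(2ηx). -/
def ell (τ η x : ℂ) : ℂ := θf τ (2*η*x)

/-- Elliptic shifted factorial [x]_k. -/
def ellFac (τ η x : ℂ) (k : ℕ) : ℂ := ∏ j ∈ Finset.range k, ell τ η (x + j)

/-! ### Part A: the Jacobi triple product -/

/-- Gaussian binomial coefficients. -/
def gb (q : ℂ) : ℕ → ℕ → ℂ
  | _, 0 => 1
  | 0, _ + 1 => 0
  | m + 1, k + 1 => q ^ (k + 1) * gb q m (k + 1) + gb q m k

/-- Finite q-factorials. -/
def qf (q : ℂ) (m : ℕ) : ℂ := ∏ j ∈ Finset.range m, (1 - q ^ (j + 1))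

lemma gb_zero (q : ℂ) (m : ℕ) : gb q m 0 = 1 := by cases m <;> rfl

lemma gb_lt (q : ℂ) (m : ℕ) : ∀ k, m < k → gb q m k = 0 := by
  induction m with
  | zero => intro k hk; cases k with
    | zero => omega
    | succ k => rfl
  | succ m ih => intro k hk; cases k with
    | zero => omega
    | succ k => simp only [gb]; rw [ih _ (by omega), ih _ (by omega)]; simp

lemma gb_sum (q : ℂ) (m : ℕ) : ∀ x : ℂ, ∏ j ∈ Finset.range m, (1 + x * q ^ j) =
    ∑ k ∈ Finset.range (m + 1), q ^ (k.choose 2) * gb q m k * x ^ k := by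
  induction m with
  | zero => intro x; simp [gb]
  | succ m ih =>
    intro x
    have h1 : ∏ j ∈ Finset.range (m + 1), (1 + x * q ^ j)
        = (∏ j ∈ Finset.range m, (1 + (x * q) * q ^ j)) * (1 + x) := by
      rw [Finset.prod_range_succ']
      congr 1
      · apply Finset.prod_congr rfl; intro j _; ring
      · simp
    rw [h1, ih]
    conv_rhs => rw [Finset.sum_range_succ']
    have h2 : ∀ k ∈ Finset.range (m + 1),
        q ^ ((k + 1).choose 2) * gb q (m + 1) (k + 1) * x ^ (k + 1) =
        (q ^ ((k + 1).choose 2) * gb q m (k + 1) * (x * q) ^ (k + 1)) +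
         x * (q ^ (k.choose 2) * gb q m k * (x * q) ^ k) := by
      intro k _
      have : (k + 1).choose 2 = k.choose 2 + k := by
        rw [Nat.choose_succ_succ' k 1]; simp [add_comm]
      simp only [gb]; rw [this]; ring
    rw [Finset.sum_congr rfl h2, Finset.sum_add_distrib, ← Finset.mul_sum, mul_add, mul_one,
      mul_comm _ x]
    have h3 : ∑ k ∈ Finset.range (m + 1), q ^ (k.choose 2) * gb q m k * (x * q) ^ k =
        ∑ k ∈ Finset.range (m + 1), q ^ ((k + 1).choose 2) * gb q m (k + 1) * (x * q) ^ (k + 1)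
          + 1 := by
      rw [Finset.sum_range_succ (fun k => q ^ ((k + 1).choose 2) * gb q m (k + 1) *
        (x * q) ^ (k + 1)) m, gb_lt q m (m + 1) (by omega), Finset.sum_range_succ']
      simp [gb_zero]
    have h4 : q ^ (Nat.choose 0 2) * gb q (m + 1) 0 * x ^ 0 = 1 := by simp [gb_zero]
    rw [h4]
    linear_combination h3

lemma gb_qf (q : ℂ) (k l : ℕ) : gb q (k + l) k * (qf q k * qf q l) = qf q (k + l) := by
  have key : ∀ m k l : ℕ, k + l = m → gb q m k * (qf q k * qf q l) = qf q m := by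
    intro m
    induction m with
    | zero =>
      intro k l h
      have hk : k = 0 := by omega
      have hl : l = 0 := by omega
      subst hk hl; simp [gb, qf]
    | succ m ih =>
      intro k l h
      cases k with
      | zero => have : l = m + 1 := by omega
                subst this; simp [gb_zero, qf]
      | succ k =>
        cases l with
        | zero =>
          have : k = m := by omega
          subst this
          simp only [gb]
          rw [gb_lt q k (k + 1) (by omega)]
          have := ih k 0 (by omega)
          have e : qf q (k + 1) = qf q k * (1 - q ^ (k + 1)) := by
            simp [qf, Finset.prod_range_succ]
          rw [e]; linear_combination (1 - q ^ (k + 1)) * this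
        | succ l =>
          have i1 := ih (k + 1) l (by omega)
          have i2 := ih k (l + 1) (by omega)
          have e : ∀ j, qf q (j + 1) = qf q j * (1 - q ^ (j + 1)) := by
            intro j; simp [qf, Finset.prod_range_succ]
          simp only [gb]
          rw [e m]
          have hm : q ^ (m + 1) = q ^ (k + 1) * q ^ (l + 1) := by rw [← pow_add]; congr 1; omega
          rw [hm]
          rw [e k] at i1 ⊢
          rw [e l] at i2 ⊢
          linear_combination q ^ (k + 1) * (1 - q ^ (l + 1)) * i1 + (1 - q ^ (k + 1)) * i2
  exact key _ _ _ rfl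

lemma sum_q {q : ℂ} (hq : ‖q‖ < 1) (a : ℂ) : Summable fun j : ℕ => ‖-(a * q ^ j)‖ := by
  simp only [norm_neg, norm_mul, norm_pow]
  exact (summable_geometric_of_lt_one (norm_nonneg _) hq).mul_left _

lemma mult_q {q : ℂ} (hq : ‖q‖ < 1) (a : ℂ) : Multipliable fun j : ℕ => (1 - a * q ^ j) := by
  simpa [sub_eq_add_neg] using multipliable_one_add_of_summable (sum_q hq a)

lemma qPoch_ne {q : ℂ} (hq : ‖q‖ < 1) (a : ℂ) (h : ∀ j : ℕ, 1 - a * q ^ j ≠ 0) :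
    qPoch a q ≠ 0 := by
  have := tprod_one_add_ne_zero_of_summable (f := fun j : ℕ => -(a * q ^ j))
    (by simpa [sub_eq_add_neg] using h) (sum_q hq a)
  simpa [qPoch, sub_eq_add_neg] using this

lemma qf_tendsto {q : ℂ} (hq : ‖q‖ < 1) :
    Filter.Tendsto (qf q) Filter.atTop (nhds (qPoch q q)) := by
  have := (mult_q hq q).hasProd.tendsto_prod_nat
  refine this.congr (fun n => ?_)
  simp only [qf]
  apply Finset.prod_congr rfl; intro j _; ring

lemma one_sub_pow_ne {q : ℂ} (hq : ‖q‖ < 1) (j : ℕ) : 1 - q ^ (j + 1) ≠ 0 := by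
  intro h
  have h2 : q ^ (j + 1) = 1 := by linear_combination -h
  have h3 : ‖q‖ ^ (j + 1) = 1 := by rw [← norm_pow, h2]; simp
  have := pow_lt_one₀ (norm_nonneg q) hq (Nat.succ_ne_zero j)
  rw [Nat.succ_eq_add_one] at this
  linarith

lemma qPochqq_ne {q : ℂ} (hq : ‖q‖ < 1) : qPoch q q ≠ 0 := by
  apply qPoch_ne hq
  intro j
  have := one_sub_pow_ne hq j
  rwa [pow_succ'] at this

lemma qf_ne {q : ℂ} (hq : ‖q‖ < 1) (m : ℕ) : qf q m ≠ 0 :=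
  Finset.prod_ne_zero_iff.mpr fun j _ => one_sub_pow_ne hq j

/-- summand of `θf`. -/
def thT (τ x : ℂ) (n : ℤ) : ℂ := (-1 : ℂ) ^ n *
    Complex.exp (cπ * I * τ * ((n : ℂ) - 1/2)^2 + cπ * I * (2*(n : ℂ) - 1) * x)

lemma thT_eq (τ x : ℂ) (n : ℤ) : thT τ x n =
    Complex.exp (cπ * I * (τ / 4 - x)) * jacobiTheta₂_term n (x + 1/2 - τ/2) τ := by
  unfold thT jacobiTheta₂_term cπ
  have : (-1 : ℂ) ^ n = Complex.exp (n * (Real.pi * I)) := by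
    rw [Complex.exp_int_mul, Complex.exp_pi_mul_I]
  rw [this, ← Complex.exp_add, ← Complex.exp_add]
  congr 1; ring

lemma thT_summable {τ : ℂ} (hτ : 0 < τ.im) (x : ℂ) : Summable (thT τ x) := by
  have := (hasSum_jacobiTheta₂_term (x + 1/2 - τ/2) hτ).summable.mul_left
    (Complex.exp (cπ * I * (τ / 4 - x)))
  exact this.congr (fun n => (thT_eq τ x n).symm)

lemma θf_eq {τ : ℂ} (x : ℂ) : θf τ x =
    I * Complex.exp (cπ * I * (τ / 4 - x)) * jacobiTheta₂ (x + 1/2 - τ/2) τ := by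
  have : θf τ x = I * ∑' n : ℤ, thT τ x n := rfl
  rw [this, tsum_congr (thT_eq τ x), tsum_mul_left, jacobiTheta₂, ← mul_assoc]

lemma prod_exp_aux (τ x : ℂ) (n : ℕ) :
    ∏ j ∈ Finset.range n, (-(Complex.exp (2*cπ*I*x - 2*cπ*I*τ*(j+1)))) =
    (-1)^n * Complex.exp (2*cπ*I*n*x - cπ*I*τ*n*(n+1)) := by
  induction n with
  | zero => simp
  | succ n ih =>
    rw [Finset.prod_range_succ, ih, pow_succ]
    have : Complex.exp (2*cπ*I*(n+1:ℕ)*x - cπ*I*τ*(n+1:ℕ)*((n+1:ℕ)+1)) =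
      Complex.exp (2*cπ*I*n*x - cπ*I*τ*n*(n+1)) *
      Complex.exp (2*cπ*I*x - 2*cπ*I*τ*(n+1)) := by
      rw [← Complex.exp_add]; congr 1; push_cast; ring
    rw [this]; ring

lemma triple_fin (τ x : ℂ) (n : ℕ) :
    ∑ k ∈ Finset.range (2 * n + 1), gb (Complex.exp (2*cπ*I*τ)) (2 * n) k * thT τ x ((k:ℤ) - n) =
    Complex.exp (cπ * I * (τ / 4 - x)) *
     ((∏ j ∈ Finset.range n, (1 - Complex.exp (2*cπ*I*x) * Complex.exp (2*cπ*I*τ) ^ j)) *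
      ∏ j ∈ Finset.range n, (1 - Complex.exp (2*cπ*I*τ) * Complex.exp (-(2*cπ*I*x)) *
        Complex.exp (2*cπ*I*τ) ^ j)) := by
  set q := Complex.exp (2*cπ*I*τ) with hq
  set x0 := -Complex.exp (2*cπ*I*x - 2*cπ*I*τ*n) with hx0
  have h := gb_sum q (2 * n) x0
  have e1 : ∏ j ∈ Finset.range (2 * n), (1 + x0 * q ^ j) =
      (∏ j ∈ Finset.range n, (1 - q * Complex.exp (-(2*cπ*I*x)) * q ^ j)) *
      (∏ j ∈ Finset.range n, (-(Complex.exp (2*cπ*I*x - 2*cπ*I*τ*(j+1))))) *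
      (∏ j ∈ Finset.range n, (1 - Complex.exp (2*cπ*I*x) * q ^ j)) := by
    rw [two_mul, Finset.prod_range_add]
    congr 1
    · rw [← Finset.prod_mul_distrib, ← Finset.prod_range_reflect]
      apply Finset.prod_congr rfl
      intro j hj
      have hj' : j < n := Finset.mem_range.mp hj
      have : ((n - 1 - j : ℕ) : ℂ) = n - 1 - j := by
        rw [Nat.cast_sub (by omega), Nat.cast_sub (by omega)]; simp
      rw [hx0, hq, ← Complex.exp_nat_mul, ← Complex.exp_nat_mul, this, neg_mul, ← Complex.exp_add,
        ← Complex.exp_add, ← Complex.exp_add]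
      have a1 : 2 * cπ * I * τ + -(2 * cπ * I * x) + ↑j * (2 * cπ * I * τ) +
        (2 * cπ * I * x - 2 * cπ * I * τ * (↑j + 1)) = 0 := by ring
      have a2 : 2 * cπ * I * x - 2 * cπ * I * τ * ↑n + (↑n - 1 - ↑j) * (2 * cπ * I * τ) =
        2 * cπ * I * x - 2 * cπ * I * τ * (↑j + 1) := by ring
      rw [a2]
      have a3 := congrArg Complex.exp a1
      rw [Complex.exp_add, Complex.exp_zero] at a3
      linear_combination -a3
    · apply Finset.prod_congr rfl
      intro j hj
      rw [hx0, hq, ← Complex.exp_nat_mul, ← Complex.exp_nat_mul, neg_mul, ← Complex.exp_add,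
        ← Complex.exp_add, ← sub_eq_add_neg]
      congr 2; push_cast; ring
  rw [e1, prod_exp_aux] at h
  have hc : (-1:ℂ)^n * (-1)^n = 1 := by rw [← mul_pow]; simp
  have hE : Complex.exp (2*cπ*I*n*x - cπ*I*τ*n*(n+1)) *
    Complex.exp (-(2*cπ*I*n*x - cπ*I*τ*n*(n+1))) = 1 := by rw [← Complex.exp_add]; simp
  have e2 : ∀ k ∈ Finset.range (2 * n + 1), gb q (2 * n) k * thT τ x ((k:ℤ) - n) =
     (Complex.exp (cπ * I * (τ / 4 - x)) * ((-1) ^ n *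
      Complex.exp (-(2*cπ*I*n*x - cπ*I*τ*n*(n+1))))) *
      (q ^ (k.choose 2) * gb q (2 * n) k * x0 ^ k) := by
    intro k _
    have hk : ((k.choose 2 : ℕ) : ℂ) = k * (k - 1) / 2 := by
      rw [Nat.cast_choose_two]
    have hs : (-1 : ℂ) ^ ((k:ℤ) - n) = (-1) ^ n * (-1) ^ k := by
      rw [zpow_sub₀ (by norm_num), zpow_natCast, zpow_natCast, div_eq_iff (by simp)]
      linear_combination -(-1 : ℂ) ^ k * hc
    unfold thT
    rw [hs, hx0, hq, neg_pow (Complex.exp _) k, ← Complex.exp_nat_mul, ← Complex.exp_nat_mul, hk]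
    have : Complex.exp (cπ * I * τ * ((((k:ℤ) - n : ℤ) : ℂ) - 1/2)^2 +
        cπ * I * (2*(((k:ℤ) - n : ℤ) : ℂ) - 1) * x) =
       Complex.exp (cπ * I * (τ / 4 - x)) * Complex.exp (-(2*cπ*I*n*x - cπ*I*τ*n*(n+1))) *
       Complex.exp (↑k * (↑k - 1) / 2 * (2 * cπ * I * τ)) *
       Complex.exp (↑k * (2 * cπ * I * x - 2 * cπ * I * τ * ↑n)) := by
      rw [← Complex.exp_add, ← Complex.exp_add, ← Complex.exp_add]
      congr 1; push_cast; ring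
    rw [this]; ring
  rw [Finset.sum_congr rfl e2, ← Finset.mul_sum, ← h]
  set P1 := ∏ j ∈ Finset.range n, (1 - q * Complex.exp (-(2*cπ*I*x)) * q ^ j)
  set P2 := ∏ j ∈ Finset.range n, (1 - Complex.exp (2*cπ*I*x) * q ^ j)
  set e3 := Complex.exp (cπ * I * (τ / 4 - x))
  linear_combination e3 * P1 * P2 * ((-1)^n * (-1)^n) * hE + e3 * P1 * P2 * hc

lemma norm_q {τ : ℂ} (hτ : 0 < τ.im) : ‖Complex.exp (2*cπ*I*τ)‖ < 1 := by
  rw [Complex.norm_exp]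
  have : (2 * cπ * I * τ).re = -(2 * Real.pi * τ.im) := by
    simp [cπ]
  rw [this]
  rw [← Real.exp_zero]; apply Real.exp_lt_exp.mpr
  have := Real.pi_pos
  have : 0 < 2 * Real.pi * τ.im := by positivity
  linarith

theorem triple {τ : ℂ} (hτ : 0 < τ.im) (x : ℂ) :
    θf τ x = I * Complex.exp (cπ * I * (τ / 4 - x)) *
     (qPoch (Complex.exp (2*cπ*I*τ)) (Complex.exp (2*cπ*I*τ)) *
      qPoch (Complex.exp (2*cπ*I*x)) (Complex.exp (2*cπ*I*τ)) *
      qPoch (Complex.exp (2*cπ*I*τ) * Complex.exp (-(2*cπ*I*x))) (Complex.exp (2*cπ*I*τ))) := by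
  have hq1 := norm_q hτ
  have tf := triple_fin τ x
  set q := Complex.exp (2*cπ*I*τ) with hq
  set P := qPoch q q
  have hP : P ≠ 0 := qPochqq_ne hq1
  -- bound of 1/qf and qf
  have hinv : Filter.Tendsto (fun m => (qf q m)⁻¹) Filter.atTop (nhds P⁻¹) :=
    (qf_tendsto hq1).inv₀ hP
  obtain ⟨M1, hM1⟩ := (qf_tendsto hq1).norm.bddAbove_range
  obtain ⟨M2, hM2⟩ := hinv.norm.bddAbove_range
  have hM1' : ∀ m, ‖qf q m‖ ≤ M1 := fun m => hM1 ⟨m, rfl⟩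
  have hM2' : ∀ m, ‖(qf q m)⁻¹‖ ≤ M2 := fun m => hM2 ⟨m, rfl⟩
  let a : ℕ → ℤ → ℂ := fun n l => if l.natAbs ≤ n then gb q (2 * n) (n + l).toNat else 0
  have gbf : ∀ n (l : ℤ), l.natAbs ≤ n → gb q (2 * n) (n + l).toNat =
      qf q (2 * n) * (qf q (n + l).toNat)⁻¹ * (qf q (n - l).toNat)⁻¹ := by
    intro n l hl
    have := gb_qf q (n + l).toNat (n - l).toNat
    have e : (n + l).toNat + (n - l).toNat = 2 * n := by omega
    rw [e] at this
    rw [← this]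
    field_simp [qf_ne hq1]
  have hlim : Filter.Tendsto (fun n => ∑' l : ℤ, a n l * thT τ x l) Filter.atTop
      (nhds (∑' l : ℤ, P⁻¹ * thT τ x l)) := by
    apply tendsto_tsum_of_dominated_convergence (bound := fun l => M1 * M2 * M2 * ‖thT τ x l‖)
    · exact (thT_summable hτ x).norm.mul_left _
    · intro l
      apply Filter.Tendsto.mul_const
      have t1 : Filter.Tendsto (fun n : ℕ => qf q (2 * n) * (qf q (n + l).toNat)⁻¹ *
          (qf q (n - l).toNat)⁻¹) Filter.atTop (nhds (P * P⁻¹ * P⁻¹)) := by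
        refine Filter.Tendsto.mul (Filter.Tendsto.mul ?_ ?_) ?_
        · exact (qf_tendsto hq1).comp (Filter.tendsto_atTop_mono (fun n => by simp only [id]; omega) Filter.tendsto_id)
        · refine hinv.comp ?_
          rw [Filter.tendsto_atTop_atTop]
          intro b; exact ⟨b + l.natAbs, fun n hn => by omega⟩
        · refine hinv.comp ?_
          rw [Filter.tendsto_atTop_atTop]
          intro b; exact ⟨b + l.natAbs, fun n hn => by omega⟩
      have e : P * P⁻¹ * P⁻¹ = P⁻¹ := by field_simp
      rw [e] at t1
      refine t1.congr' ?_
      filter_upwards [Filter.eventually_ge_atTop l.natAbs] with n hn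
      simp only [a, if_pos hn]
      rw [gbf n l hn]
    · filter_upwards with n l
      rw [norm_mul]
      apply mul_le_mul_of_nonneg_right _ (norm_nonneg _)
      have h1 : 0 ≤ M1 := (norm_nonneg _).trans (hM1' 0)
      have h2 : 0 ≤ M2 := (norm_nonneg _).trans (hM2' 0)
      simp only [a]
      split_ifs with hl
      · rw [gbf n l hl, norm_mul, norm_mul]
        gcongr
        · exact hM1' _
        · exact hM2' _
        · exact hM2' _
      · simp; positivity
  have hsum : ∀ n, ∑' l : ℤ, a n l * thT τ x l =
      ∑ k ∈ Finset.range (2 * n + 1), gb q (2 * n) k * thT τ x ((k:ℤ) - n) := by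
    intro n
    have : ∑ k ∈ Finset.range (2 * n + 1), gb q (2 * n) k * thT τ x ((k:ℤ) - n) =
      ∑ l ∈ (Finset.range (2 * n + 1)).map
        ⟨fun k : ℕ => (k:ℤ) - n, fun a b h => by simpa using h⟩, a n l * thT τ x l := by
      rw [Finset.sum_map]
      apply Finset.sum_congr rfl
      intro k hk
      have := Finset.mem_range.mp hk
      change _ = (if ((k:ℤ) - n).natAbs ≤ n then gb q (2 * n) (n + ((k:ℤ) - n)).toNat else 0) *
        thT τ x ((k:ℤ) - n)
      rw [if_pos (by omega)]
      congr 2; omega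
    rw [this]
    apply tsum_eq_sum
    intro l hl
    have : ¬ l.natAbs ≤ n := by
      intro h
      apply hl
      simp only [Finset.mem_map, Finset.mem_range]
      refine ⟨(n + l).toNat, by omega, ?_⟩
      change (((n + l).toNat : ℤ)) - n = l
      omega
    simp [a, this]
  have hlim2 := ((mult_q hq1 (Complex.exp (2*cπ*I*x))).hasProd.tendsto_prod_nat.mul
    (mult_q hq1 (q * Complex.exp (-(2*cπ*I*x)))).hasProd.tendsto_prod_nat).const_mul
      (Complex.exp (cπ * I * (τ / 4 - x)))
  have huniq := tendsto_nhds_unique (hlim.congr (fun n => (hsum n).trans (tf n))) hlim2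
  rw [tsum_mul_left] at huniq
  have : θf τ x = I * ∑' n : ℤ, thT τ x n := rfl
  rw [this]
  have h3 : ∑' n : ℤ, thT τ x n = P * (P⁻¹ * ∑' n : ℤ, thT τ x n) := by field_simp
  rw [h3, huniq]
  simp only [qPoch]
  ring

/-! ### Part B: basic properties of theta -/

lemma cexp_cπI : Complex.exp (cπ * I) = -1 := by
  simp [cπ]

lemma cexp_2cπI : Complex.exp (2 * cπ * I) = 1 := by
  simp [cπ]

lemma θ_diff {τ : ℂ} (hτ : 0 < τ.im) : Differentiable ℂ (θf τ) := by
  have : θf τ = fun x => I * Complex.exp (cπ * I * (τ / 4 - x)) *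
      jacobiTheta₂ (x + 1/2 - τ/2) τ := by funext x; exact θf_eq x
  rw [this]
  have h : Differentiable ℂ fun z => jacobiTheta₂ z τ :=
    fun z => differentiableAt_jacobiTheta₂_fst z hτ
  have h2 : Differentiable ℂ fun x : ℂ => jacobiTheta₂ (x + 1/2 - τ/2) τ :=
    h.comp (by fun_prop : Differentiable ℂ fun x : ℂ => x + 1/2 - τ/2)
  exact Differentiable.mul (by fun_prop) h2

lemma θ_cont {τ : ℂ} (hτ : 0 < τ.im) : Continuous (θf τ) := (θ_diff hτ).continuous

lemma θ_add_one (τ x : ℂ) : θf τ (x + 1) = -θf τ x := by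
  rw [θf_eq, θf_eq]
  have e : x + 1 + 1/2 - τ/2 = (x + 1/2 - τ/2) + 1 := by ring
  rw [e, jacobiTheta₂_add_left]
  have e2 : Complex.exp (cπ * I * (τ / 4 - x)) = Complex.exp (cπ * I * (τ / 4 - (x + 1))) *
      Complex.exp (cπ * I) := by rw [← Complex.exp_add]; congr 1; ring
  rw [e2, cexp_cπI]; ring

lemma θ_add_tau (τ x : ℂ) : θf τ (x + τ) = -Complex.exp (-cπ*I*τ - 2*cπ*I*x) * θf τ x := by
  rw [θf_eq, θf_eq]
  have e : x + τ + 1/2 - τ/2 = (x + 1/2 - τ/2) + τ := by ring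
  rw [e, jacobiTheta₂_add_left']
  have e2 : Complex.exp (cπ * I * (τ / 4 - (x + τ))) *
      Complex.exp (-Real.pi * I * (τ + 2 * (x + 1/2 - τ/2))) * Complex.exp (cπ * I) =
      Complex.exp (-cπ*I*τ - 2*cπ*I*x) * Complex.exp (cπ * I * (τ / 4 - x)) := by
    rw [← Complex.exp_add, ← Complex.exp_add, ← Complex.exp_add]; congr 1; simp only [cπ]; ring
  rw [cexp_cπI] at e2
  linear_combination (-I * jacobiTheta₂ (x + 1/2 - τ/2) τ) * e2

lemma θ_neg (τ x : ℂ) : θf τ (-x) = -θf τ x := by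
  have h1 := θ_add_tau τ (-x - τ)
  have e1 : -x - τ + τ = -x := by ring
  rw [e1] at h1
  rw [h1, θf_eq, θf_eq]
  have e : -x - τ + 1/2 - τ/2 = -((x + 1/2 - τ/2) + τ + τ - 1) := by ring
  have e3 : x + 1/2 - τ/2 + τ + τ - 1 + 1 = x + 1/2 - τ/2 + τ + τ := by ring
  have h2 := jacobiTheta₂_add_left ((x + 1/2 - τ/2) + τ + τ - 1) τ
  rw [e3] at h2
  rw [e, jacobiTheta₂_neg_left, ← h2, jacobiTheta₂_add_left', jacobiTheta₂_add_left']
  have e2 : Complex.exp (-cπ*I*τ - 2*cπ*I*(-x-τ)) * Complex.exp (cπ * I * (τ / 4 - (-x - τ))) *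
      Complex.exp (-Real.pi * I * (τ + 2 * (x + 1/2 - τ/2 + τ))) *
      Complex.exp (-Real.pi * I * (τ + 2 * (x + 1/2 - τ/2))) * Complex.exp (2 * cπ * I) =
      Complex.exp (cπ * I * (τ / 4 - x)) := by
    rw [← Complex.exp_add, ← Complex.exp_add, ← Complex.exp_add, ← Complex.exp_add]
    congr 1; simp only [cπ]; ring
  rw [cexp_2cπI] at e2
  linear_combination (-I * jacobiTheta₂ (x + 1/2 - τ/2) τ) * e2

lemma θ_zero (τ : ℂ) : θf τ 0 = 0 := by
  have := θ_neg τ 0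
  rw [neg_zero] at this
  linear_combination this / 2

lemma θ_conj {τ : ℂ} {t : ℝ} (hτ : τ = t * I) (x : ℂ) :
    (starRingEnd ℂ) (θf τ x) = θf τ ((starRingEnd ℂ) x) := by
  have hc : (starRingEnd ℂ) τ = -τ := by rw [hτ]; simp
  have hcp : (starRingEnd ℂ) cπ = cπ := by simp [cπ]
  rw [θf_eq, θf_eq]
  simp only [map_mul, ← Complex.exp_conj, jacobiTheta₂_conj, map_sub, map_add, map_div₀, hc, hcp,
    conj_I, map_one, map_ofNat, neg_neg]
  have e : (starRingEnd ℂ) x + 1/2 - -τ/2 = ((starRingEnd ℂ) x + 1/2 - τ/2) + τ := by ring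
  rw [e, jacobiTheta₂_add_left']
  have e2 : Complex.exp (cπ * -I * (-τ / 4 - (starRingEnd ℂ) x)) *
      Complex.exp (-Real.pi * I * (τ + 2 * ((starRingEnd ℂ) x + 1/2 - τ/2))) *
        Complex.exp (cπ * I) =
      Complex.exp (cπ * I * (τ / 4 - (starRingEnd ℂ) x)) := by
    rw [← Complex.exp_add, ← Complex.exp_add]; congr 1; simp only [cπ]; ring
  rw [cexp_cπI] at e2
  linear_combination (I * jacobiTheta₂ ((starRingEnd ℂ) x + 1/2 - τ/2) τ) * e2

lemma exp_one_aux {y : ℂ} (h : Complex.exp (2*cπ*I*y) = 1) : ∃ m : ℤ, y = m := by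
  obtain ⟨n, hn⟩ := Complex.exp_eq_one_iff.mp h
  refine ⟨n, ?_⟩
  have hp : (2 * (Real.pi:ℂ) * I) ≠ 0 := by
    simp [Real.pi_ne_zero]
  apply mul_left_cancel₀ hp
  rw [show (2 * (Real.pi:ℂ) * I * y) = 2*cπ*I*y by rfl, hn]; ring

lemma θ_zeros {τ : ℂ} (hτ : 0 < τ.im) {x : ℂ} (h : θf τ x = 0) : ∃ m n : ℤ, x = m + n * τ := by
  rw [triple hτ] at h
  have hq := norm_q hτ
  by_contra hne
  push Not at hne
  have h1 : qPoch (Complex.exp (2*cπ*I*x)) (Complex.exp (2*cπ*I*τ)) ≠ 0 := by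
    apply qPoch_ne hq
    intro j hj
    have : Complex.exp (2*cπ*I*(x + j * τ)) = 1 := by
      rw [show 2*cπ*I*(x + j * τ) = 2*cπ*I*x + j * (2*cπ*I*τ) by ring, Complex.exp_add,
        Complex.exp_nat_mul]
      linear_combination -hj
    obtain ⟨m, hm⟩ := exp_one_aux this
    apply hne m (-j)
    push_cast
    linear_combination hm
  have h2 : qPoch (Complex.exp (2*cπ*I*τ) * Complex.exp (-(2*cπ*I*x)))
      (Complex.exp (2*cπ*I*τ)) ≠ 0 := by
    apply qPoch_ne hq
    intro j hj
    have : Complex.exp (2*cπ*I*((j + 1) * τ - x)) = 1 := by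
      rw [show 2*cπ*I*((j + 1) * τ - x) = 2*cπ*I*τ + -(2*cπ*I*x) + j * (2*cπ*I*τ) by ring,
        Complex.exp_add, Complex.exp_add, Complex.exp_nat_mul]
      linear_combination -hj
    obtain ⟨m, hm⟩ := exp_one_aux this
    apply hne (-m) (j + 1)
    push_cast
    linear_combination -hm
  have h3 := qPochqq_ne hq
  have h4 := Complex.exp_ne_zero (cπ * I * (τ / 4 - x))
  simp [h1, h2, h3, h4] at h

lemma θ_ne_im {τ : ℂ} {t : ℝ} (ht : 0 < t) (hτ : τ = t * I) {x : ℂ} (h0 : 0 < x.im)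
    (h1 : x.im < t) : θf τ x ≠ 0 := by
  intro h
  obtain ⟨m, n, hmn⟩ := θ_zeros (by simp [hτ, ht]) h
  have : x.im = n * t := by rw [hmn, hτ]; simp
  rw [this] at h0 h1
  have a : (0:ℝ) < n := by by_contra hc; push Not at hc; nlinarith
  have b : (n:ℝ) < 1 := by by_contra hc; push Not at hc; nlinarith
  have a' : 0 < n := by exact_mod_cast a
  have b' : n < 1 := by exact_mod_cast b
  omega

lemma θ_ne_re {τ : ℂ} {t : ℝ} (ht : 0 < t) (hτ : τ = t * I) {x : ℂ} (h0 : 0 < x.re)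
    (h1 : x.re < 1) : θf τ x ≠ 0 := by
  intro h
  obtain ⟨m, n, hmn⟩ := θ_zeros (by simp [hτ, ht]) h
  have : x.re = m := by rw [hmn, hτ]; simp
  rw [this] at h0 h1
  have a' : 0 < m := by exact_mod_cast h0
  have b' : m < 1 := by exact_mod_cast h1
  omega

lemma qPoch_cont {q : ℂ} (hq : ‖q‖ < 1) : Continuous fun a => qPoch a q := by
  rw [continuous_iff_continuousAt]
  intro a0
  have hu : Summable fun j : ℕ => (‖a0‖ + 1) * ‖q‖ ^ j :=
    (summable_geometric_of_lt_one (norm_nonneg _) hq).mul_left _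
  have h := (hu.hasProdLocallyUniformlyOn_nat_one_add (K := Metric.ball (0:ℂ) (‖a0‖ + 1))
    (f := fun j a => -(a * q ^ j)) Metric.isOpen_ball
    (Filter.Eventually.of_forall fun n x hx => by
      simp only [norm_neg, norm_mul, norm_pow]
      have : ‖x‖ < ‖a0‖ + 1 := by simpa using hx
      gcongr) (fun n => by fun_prop)).tendstoLocallyUniformlyOn_finsetRange
  have hc := h.continuousOn (Filter.Eventually.of_forall fun n => by fun_prop).frequently
  have := hc.continuousAt (Metric.isOpen_ball.mem_nhds (x := a0) (by simp))
  simpa [qPoch, sub_eq_add_neg] using this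

lemma qPoch_succ {q : ℂ} (hq : ‖q‖ < 1) (a : ℂ) : qPoch a q = (1 - a) * qPoch (q * a) q := by
  have e : (fun j : ℕ => 1 - (q * a) * q ^ j) = fun j : ℕ => (1 - a * q ^ (j + 1)) := by
    funext j; ring
  have hm : Multipliable fun j : ℕ => (1 - a * q ^ (j + 1)) := by
    rw [← e]; exact mult_q hq (q * a)
  have h := tprod_eq_zero_mul' (f := fun j : ℕ => (1 - a * q ^ j)) hm
  have h2 : qPoch a q = ∏' j : ℕ, (1 - a * q ^ j) := rfl
  have h3 : qPoch (q * a) q = ∏' j : ℕ, (1 - a * q ^ (j + 1)) := by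
    rw [← e]; rfl
  rw [h2, h3, h, pow_zero, mul_one]

theorem θ_deriv0 {τ : ℂ} (hτ : 0 < τ.im) :
    HasDerivAt (θf τ) (2 * cπ * Complex.exp (cπ * I * (τ / 4)) *
      qPoch (Complex.exp (2*cπ*I*τ)) (Complex.exp (2*cπ*I*τ)) ^ 3) 0 := by
  have hq := norm_q hτ
  set q := Complex.exp (2*cπ*I*τ) with hqd
  let G : ℂ → ℂ := fun x => I * Complex.exp (cπ * I * (τ / 4 - x)) *
     (qPoch q q * qPoch (q * Complex.exp (2*cπ*I*x)) q * qPoch (q * Complex.exp (-(2*cπ*I*x))) q)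
  have hG : Continuous G := by
    have h1 : Continuous fun x : ℂ => qPoch (q * Complex.exp (2*cπ*I*x)) q :=
      (qPoch_cont hq).comp (by fun_prop : Continuous fun x : ℂ => q * Complex.exp (2*cπ*I*x))
    have h2 : Continuous fun x : ℂ => qPoch (q * Complex.exp (-(2*cπ*I*x))) q :=
      (qPoch_cont hq).comp (by fun_prop : Continuous fun x : ℂ => q * Complex.exp (-(2*cπ*I*x)))
    simp only [G]
    fun_prop
  have hfac : ∀ x, θf τ x = (1 - Complex.exp (2*cπ*I*x)) * G x := by
    intro x
    rw [triple hτ, qPoch_succ hq (Complex.exp (2*cπ*I*x))]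
    simp only [G]; ring
  have hE : HasDerivAt (fun x : ℂ => 1 - Complex.exp (2*cπ*I*x)) (-(2*cπ*I)) 0 := by
    have := (((hasDerivAt_id (0:ℂ)).const_mul (2*cπ*I)).cexp).const_sub 1
    simpa using this
  have : HasDerivAt (fun x => (1 - Complex.exp (2*cπ*I*x)) * G x) (-(2*cπ*I) * G 0) 0 := by
    rw [hasDerivAt_iff_tendsto_slope] at hE ⊢
    have h2 := hE.mul (hG.tendsto 0 |>.mono_left nhdsWithin_le_nhds)
    refine h2.congr' ?_
    filter_upwards with x
    simp [slope]; ring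
  have e : θf τ = fun x => (1 - Complex.exp (2*cπ*I*x)) * G x := funext hfac
  rw [e]
  convert this using 1
  simp only [G, mul_zero, neg_zero, Complex.exp_zero, mul_one, sub_zero]
  linear_combination (2 * cπ * Complex.exp (cπ * I * (τ / 4)) * qPoch q q ^ 3) * I_sq

lemma θ_shift {τ : ℂ} (m n : ℤ) : ∃ a b : ℂ, ∀ x, θf τ (x + (m + n * τ)) =
    Complex.exp (a + b * x) * θf τ x := by
  let P : ℂ → Prop := fun l => ∃ a b : ℂ, ∀ x, θf τ (x + l) = Complex.exp (a + b * x) * θf τ x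
  have P0 : P 0 := ⟨0, 0, fun x => by simp⟩
  have P1 : P 1 := ⟨cπ * I, 0, fun x => by rw [θ_add_one, zero_mul, add_zero, cexp_cπI]; ring⟩
  have Pt : P τ := ⟨cπ * I - cπ*I*τ, -2*cπ*I, fun x => by
    rw [θ_add_tau, show cπ * I - cπ*I*τ + -2*cπ*I * x = cπ * I + (-cπ*I*τ - 2*cπ*I*x) by ring,
      Complex.exp_add, cexp_cπI]; ring⟩
  have Pa : ∀ l k, P l → P k → P (l + k) := by
    rintro l k ⟨a, b, h⟩ ⟨c, d, h'⟩
    refine ⟨c + d * l + a, d + b, fun x => ?_⟩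
    rw [← add_assoc, h' (x + l), h x, ← mul_assoc, ← Complex.exp_add]
    congr 2; ring
  have Pn : ∀ l, P l → P (-l) := by
    rintro l ⟨a, b, h⟩
    refine ⟨-a + b * l, -b, fun x => ?_⟩
    have := h (x + -l)
    rw [neg_add_cancel_right] at this
    rw [this, ← mul_assoc, ← Complex.exp_add]
    have e : -a + b * l + -b * x + (a + b * (x + -l)) = 0 := by ring
    rw [e]; simp
  have Pz : ∀ l, P l → ∀ k : ℤ, P (k * l) := by
    intro l hl k
    induction k using Int.induction_on with
    | zero => simpa using P0
    | succ k ih => have := Pa _ _ ih hl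
                   push_cast at this ⊢
                   rwa [add_mul, one_mul]
    | pred k ih => have := Pa _ _ ih (Pn _ hl)
                   push_cast at this ⊢
                   rwa [sub_mul, one_mul, sub_eq_add_neg]
  have := Pa _ _ (Pz 1 P1 m) (Pz τ Pt n)
  rw [mul_one] at this
  exact this

lemma θ_simple {τ : ℂ} (hτ : 0 < τ.im) {x : ℂ} (h : θf τ x = 0) : deriv (θf τ) x ≠ 0 := by
  obtain ⟨m, n, rfl⟩ := θ_zeros hτ h
  obtain ⟨a, b, hab⟩ := θ_shift (τ := τ) m n
  set l : ℂ := m + n * τ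
  have e : θf τ = fun z => Complex.exp (a + b * (z - l)) * θf τ (z - l) := by
    funext z; rw [← hab, sub_add_cancel]
  have h0 := θ_deriv0 hτ
  set d := 2 * cπ * Complex.exp (cπ * I * (τ / 4)) *
      qPoch (Complex.exp (2*cπ*I*τ)) (Complex.exp (2*cπ*I*τ)) ^ 3 with hd
  have hdne : d ≠ 0 := by
    have := qPochqq_ne (norm_q hτ)
    have h2 : cπ ≠ 0 := by simp [cπ, Real.pi_ne_zero]
    simp [hd, this, h2]
  have h1 : HasDerivAt (fun z => θf τ (z - l)) d l := by
    have h0' : HasDerivAt (θf τ) d (l - l) := by rwa [sub_self]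
    exact h0'.comp_sub_const l l
  have h2 : HasDerivAt (fun z => Complex.exp (a + b * (z - l)))
     (Complex.exp (a + b * (l - l)) * (b * 1)) l :=
    ((((hasDerivAt_id l).sub_const l).const_mul b).const_add a).cexp
  have h3 := h2.mul h1
  simp only [sub_self, θ_zero, mul_zero, zero_add, add_zero] at h3
  have h4 : HasDerivAt (θf τ) (Complex.exp a * d) l := by
    rw [e]; exact h3
  rw [h4.deriv]
  exact mul_ne_zero (Complex.exp_ne_zero _) hdne

/-! ### Part C: quotients, quasi-periodic functions -/

/-- entire with only simple zeros -/
def Simp (g : ℂ → ℂ) : Prop := Differentiable ℂ g ∧ ∀ z, g z = 0 → deriv g z ≠ 0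

lemma Simp.ev {g : ℂ → ℂ} (hg : Simp g) (z : ℂ) : ∀ᶠ w in nhdsWithin z {z}ᶜ, g w ≠ 0 := by
  by_cases h : g z = 0
  · have := (hg.1 z).hasDerivAt.eventually_ne (c := 0) (hg.2 z h)
    exact this
  · exact (hg.1.continuous.continuousAt.eventually_ne h).filter_mono nhdsWithin_le_nhds

lemma ext_simp {g h₁ h₂ : ℂ → ℂ} (hg : Simp g) (c₁ : Continuous h₁) (c₂ : Continuous h₂)
    (h : ∀ z, g z ≠ 0 → h₁ z = h₂ z) (z : ℂ) : h₁ z = h₂ z := by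
  have e : h₁ =ᶠ[nhdsWithin z {z}ᶜ] h₂ := (hg.ev z).mono fun w hw => h w hw
  have t₁ : Filter.Tendsto h₁ (nhdsWithin z {z}ᶜ) (nhds (h₁ z)) :=
    (c₁.tendsto z).mono_left nhdsWithin_le_nhds
  have t₂ : Filter.Tendsto h₂ (nhdsWithin z {z}ᶜ) (nhds (h₂ z)) :=
    (c₂.tendsto z).mono_left nhdsWithin_le_nhds
  exact tendsto_nhds_unique (t₁.congr' e) t₂

lemma div_exists {f g : ℂ → ℂ} (hg : Simp g) (hf : Differentiable ℂ f)
    (h0 : ∀ z, g z = 0 → f z = 0) : ∃ h : ℂ → ℂ, Differentiable ℂ h ∧ ∀ z, g z * h z = f z := by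
  classical
  refine ⟨fun z => if g z = 0 then deriv f z / deriv g z else f z / g z, ?_, ?_⟩
  · intro z
    by_cases hz : g z = 0
    · have d1 : DifferentiableAt ℂ (dslope f z) z :=
        ((Complex.differentiableOn_dslope (s := Set.univ) (c := z) Filter.univ_mem).2
          hf.differentiableOn).differentiableAt Filter.univ_mem
      have d2 : DifferentiableAt ℂ (dslope g z) z :=
        ((Complex.differentiableOn_dslope (s := Set.univ) (c := z) Filter.univ_mem).2
          hg.1.differentiableOn).differentiableAt Filter.univ_mem
      have n2 : dslope g z z ≠ 0 := by rw [dslope_same]; exact hg.2 z hz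
      refine (d1.div d2 n2).congr_of_eventuallyEq ?_
      filter_upwards [d2.continuousAt.eventually_ne n2] with w hw
      by_cases hwz : w = z
      · subst hwz
        simp [hz, dslope_same]
      · have e1 : dslope g z w = (w - z)⁻¹ * g w := by
          rw [dslope_of_ne _ hwz, slope_def_field, hz]; ring
        have e2 : dslope f z w = (w - z)⁻¹ * f w := by
          rw [dslope_of_ne _ hwz, slope_def_field, h0 z hz]; ring
        have hgw : g w ≠ 0 := by
          intro h; apply hw; rw [e1, h, mul_zero]
        have hs : w - z ≠ 0 := sub_ne_zero.2 hwz
        simp only [hgw, if_false, Pi.div_apply]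
        rw [e1, e2]; field_simp
    · refine ((hf z).div (hg.1 z) hz).congr_of_eventuallyEq ?_
      filter_upwards [hg.1.continuous.continuousAt.eventually_ne hz] with w hw
      simp [hw]
  · intro z
    by_cases hz : g z = 0
    · simp [hz, h0 z hz]
    · simp only [hz, if_false]; field_simp

/-- theta-type quasi-periodicity -/
def Quasi (τ m : ℂ) (f : ℂ → ℂ) : Prop :=
  (∀ x, f (x + 1) = f x) ∧ ∀ x, f (x + τ) = Complex.exp (-2*cπ*I*m*(2*x + τ)) * f x

lemma Quasi.mul {τ m n : ℂ} {f g : ℂ → ℂ} (hf : Quasi τ m f) (hg : Quasi τ n g) :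
    Quasi τ (m + n) (fun x => f x * g x) := by
  refine ⟨fun x => by simp only [hf.1, hg.1], fun x => ?_⟩
  simp only [hf.2, hg.2]
  rw [show -2*cπ*I*(m + n)*(2*x + τ) = -2*cπ*I*m*(2*x + τ) + -2*cπ*I*n*(2*x + τ) by ring,
    Complex.exp_add]
  ring

lemma Quasi.sub {τ m : ℂ} {f g : ℂ → ℂ} (hf : Quasi τ m f) (hg : Quasi τ m g) :
    Quasi τ m (fun x => f x - g x) :=
  ⟨fun x => by simp only [hf.1, hg.1], fun x => by simp only [hf.2, hg.2]; ring⟩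

lemma Quasi.cmul {τ m : ℂ} {f : ℂ → ℂ} (c : ℂ) (hf : Quasi τ m f) :
    Quasi τ m (fun x => c * f x) :=
  ⟨fun x => by simp only [hf.1], fun x => by simp only [hf.2]; ring⟩

lemma Quasi.neg {τ m : ℂ} {f : ℂ → ℂ} (hf : Quasi τ m f) : Quasi τ m (fun x => f (-x)) := by
  refine ⟨fun x => ?_, fun x => ?_⟩
  · have := hf.1 (-(x + 1))
    beta_reduce
    rw [← this]; congr 1; ring
  · have := hf.2 (-(x + τ))
    rw [show -(x + τ) + τ = -x by ring] at this
    beta_reduce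
    rw [this, ← mul_assoc, ← Complex.exp_add,
      show -2*cπ*I*m*(2*x + τ) + -2*cπ*I*m*(2*-(x + τ) + τ) = 0 by ring, Complex.exp_zero, one_mul]

lemma Quasi.int {τ m : ℂ} {f : ℂ → ℂ} (hf : Quasi τ m f) (k : ℤ) (x : ℂ) :
    f (x + k * τ) = Complex.exp (-2*cπ*I*m*(2*k*x + k^2*τ)) * f x := by
  induction k using Int.induction_on with
  | zero => simp
  | succ k ih =>
    rw [show x + ((k + 1 : ℤ) : ℂ) * τ = (x + ((k:ℤ):ℂ) * τ) + τ by push_cast; ring, hf.2, ih,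
      ← mul_assoc, ← Complex.exp_add]
    congr 2; push_cast; ring
  | pred k ih =>
    have := hf.2 (x + ((-k - 1 : ℤ) : ℂ) * τ)
    rw [show x + ((-k - 1 : ℤ) : ℂ) * τ + τ = (x + ((-k:ℤ):ℂ) * τ) by push_cast; ring, ih] at this
    apply mul_left_cancel₀ (Complex.exp_ne_zero
      (-2*cπ*I*m*(2*(x + ((-k - 1 : ℤ) : ℂ) * τ) + τ)))
    rw [← this, ← mul_assoc, ← Complex.exp_add]
    congr 2; push_cast; ring

lemma Quasi.int1 {τ m : ℂ} {f : ℂ → ℂ} (hf : Quasi τ m f) (k : ℤ) (x : ℂ) :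
    f (x + k) = f x := by
  have h : Function.Periodic f 1 := hf.1
  have := h.int_mul k x
  simpa using this

lemma ThetaSp.quasi {τ : ℂ} {N : ℕ} {f : ℂ → ℂ} (hf : ThetaSp τ N f) : Quasi τ N f :=
  ⟨hf.2.1, hf.2.2.1⟩

/-- odd quasi-periodic functions vanish at half periods -/
lemma odd_zero {τ : ℂ} (hτ : 0 < τ.im) {m : ℕ} {F : ℂ → ℂ} (hF : Quasi τ m F)
    (ho : ∀ x, F (-x) = -F x) {s : ℂ} (hs : θf τ (2*s) = 0) : F s = 0 := by
  obtain ⟨a, k, h⟩ := θ_zeros hτ hs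
  have e : s = (-s + k * τ) + a := by linear_combination h
  have h1 : F s = Complex.exp (-2*cπ*I*m*(2*k*(-s) + k^2*τ)) * F (-s) := by
    conv_lhs => rw [e]
    rw [hF.int1, hF.int]
  have h2 : Complex.exp (-2*cπ*I*m*(2*k*(-s) + k^2*τ)) = 1 := by
    rw [Complex.exp_eq_one_iff]
    refine ⟨m * k * a, ?_⟩
    push_cast
    simp only [cπ]
    linear_combination (2*Real.pi*I*m*k) * h
  rw [h2, ho] at h1
  linear_combination h1 / 2

lemma quasi_θ2 (τ : ℂ) : Quasi τ 2 (fun x => θf τ (2*x)) := by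
  refine ⟨fun x => ?_, fun x => ?_⟩
  · simp only
    rw [show 2*(x+1) = 2*x+1+1 by ring, θ_add_one, θ_add_one, neg_neg]
  · simp only
    rw [show 2*(x+τ) = 2*x+τ+τ by ring, θ_add_tau, θ_add_tau]
    rw [show -2*cπ*I*2*(2*x+τ) = (-cπ*I*τ - 2*cπ*I*(2*x+τ)) + (-cπ*I*τ - 2*cπ*I*(2*x)) by ring,
      Complex.exp_add]
    ring

lemma simp_θ {τ : ℂ} (hτ : 0 < τ.im) (a b : ℂ) (ha : a ≠ 0) : Simp (fun x => θf τ (a*x+b)) := by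
  have hd := θ_diff hτ
  refine ⟨hd.comp (by fun_prop : Differentiable ℂ fun x : ℂ => a*x+b), fun z hz => ?_⟩
  have h1 : HasDerivAt (fun x : ℂ => a*x+b) a z := by
    simpa using ((hasDerivAt_id z).const_mul a).add_const b
  have := (hd (a*z+b)).hasDerivAt.comp z h1
  have e : deriv (fun x => θf τ (a*x+b)) z = deriv (θf τ) (a*z+b) * a := this.deriv
  rw [e]
  exact mul_ne_zero (θ_simple hτ hz) ha

lemma simp_θ2 {τ : ℂ} (hτ : 0 < τ.im) : Simp (fun x => θf τ (2*x)) := by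
  simpa using simp_θ hτ 2 0 two_ne_zero

lemma quot_theta {τ a b σ : ℂ} {F G : ℂ → ℂ} (hG : Simp G) (hF : Differentiable ℂ F)
    (h0 : ∀ z, G z = 0 → F z = 0) (qG : Quasi τ a G) (qF : Quasi τ (a + b) F) (hσ : σ ≠ 0)
    (sG : ∀ x, G (-x) = σ * G x) (sF : ∀ x, F (-x) = σ * F x) :
    ∃ h : ℂ → ℂ, Differentiable ℂ h ∧ Quasi τ b h ∧ (∀ x, h (-x) = h x) ∧
      ∀ z, G z * h z = F z := by
  obtain ⟨h, hd, hh⟩ := div_exists hG hF h0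
  have hc := hd.continuous
  refine ⟨h, hd, ⟨?_, ?_⟩, ?_, hh⟩
  · refine ext_simp hG (h₁ := fun x => h (x+1)) (by fun_prop) hc fun z hz => ?_
    apply mul_left_cancel₀ hz
    have := hh (z+1)
    rw [qG.1, qF.1] at this
    rw [this, hh]
  · refine ext_simp hG (h₁ := fun x => h (x+τ)) (by fun_prop) (by fun_prop) fun z hz => ?_
    apply mul_left_cancel₀ hz
    apply mul_left_cancel₀ (Complex.exp_ne_zero (-2*cπ*I*a*(2*z + τ)))
    have := hh (z+τ)
    rw [qG.2, qF.2, ← hh z, show -2*cπ*I*(a+b)*(2*z + τ) =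
      -2*cπ*I*a*(2*z + τ) + -2*cπ*I*b*(2*z + τ) by ring, Complex.exp_add] at this
    linear_combination this
  · refine ext_simp hG (h₁ := fun x => h (-x)) (by fun_prop) (by fun_prop) fun z hz => ?_
    apply mul_left_cancel₀ hz
    apply mul_left_cancel₀ hσ
    have := hh (-z)
    rw [sG, sF, ← hh z] at this
    linear_combination this

lemma liouville {τ : ℂ} {t : ℝ} (ht : 0 < t) (hτ : τ = t * I) {f : ℂ → ℂ}
    (hf : Differentiable ℂ f) (q : Quasi τ 0 f) (x y : ℂ) : f x = f y := by
  apply hf.apply_eq_apply_of_bounded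
  have hK : IsCompact (Set.Icc (0:ℝ) 1 ×ℂ Set.Icc (0:ℝ) t) :=
    isCompact_Icc.reProdIm isCompact_Icc
  have hb := (hK.image hf.continuous).isBounded
  refine hb.subset ?_
  rintro _ ⟨z, rfl⟩
  set n : ℤ := ⌊z.im / t⌋ with hn
  set m : ℤ := ⌊z.re⌋ with hm
  refine ⟨z - n * τ - m, ?_, ?_⟩
  · have h1 : (n:ℝ) ≤ z.im / t := Int.floor_le _
    have h2 : z.im / t < n + 1 := Int.lt_floor_add_one _
    have h3 : (m:ℝ) ≤ z.re := Int.floor_le _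
    have h4 : z.re < m + 1 := Int.lt_floor_add_one _
    rw [le_div_iff₀ ht] at h1
    rw [div_lt_iff₀ ht] at h2
    rw [Complex.mem_reProdIm]
    simp [hτ]
    refine ⟨⟨?_, ?_⟩, ?_, ?_⟩ <;> linarith
  · have h1 := q.int n (z - n * τ - m)
    have h2 := q.int1 m (z - m)
    rw [mul_zero, zero_mul, Complex.exp_zero, one_mul,
      show z - n * τ - m + n * τ = z - m by ring] at h1
    rw [← h1, ← h2]; congr 1; ring

/-! ### Part D: the kernels and the difference operator -/

/-- K₁(u,w) -/
def k1 (τ u w : ℂ) : ℂ :=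
  Complex.exp (2*cπ*I*u) * (θf τ (u + w + 1/2 + τ/2) * θf τ (u - w + 1/2 + τ/2))

lemma θ_sub_tau (τ x : ℂ) : θf τ (x - τ) = -Complex.exp (-cπ*I*τ + 2*cπ*I*x) * θf τ x := by
  have h := θ_add_tau τ (x - τ)
  rw [sub_add_cancel] at h
  rw [h, ← mul_assoc, neg_mul_neg, ← Complex.exp_add,
    show -cπ*I*τ + 2*cπ*I*x + (-cπ*I*τ - 2*cπ*I*(x - τ)) = 0 by ring, Complex.exp_zero, one_mul]

/-- shift by half periods in the other direction -/
lemma θ_half (τ x : ℂ) : θf τ (x + 1/2 - τ/2) = Complex.exp (2*cπ*I*x) * θf τ (x + 1/2 + τ/2) := by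
  have h := θ_sub_tau τ (x + 1/2 + τ/2)
  rw [show x + 1/2 + τ/2 - τ = x + 1/2 - τ/2 by ring,
    show -cπ*I*τ + 2*cπ*I*(x + 1/2 + τ/2) = cπ*I + 2*cπ*I*x by ring, Complex.exp_add,
    cexp_cπI] at h
  rw [h]; ring

lemma θ_half_neg (τ x : ℂ) :
    θf τ (-x + 1/2 + τ/2) = Complex.exp (2*cπ*I*x) * θf τ (x + 1/2 + τ/2) := by
  rw [← θ_half]
  have h := θ_add_one τ (x - 1/2 - τ/2)
  rw [show x - 1/2 - τ/2 + 1 = x + 1/2 - τ/2 by ring] at h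
  rw [h, ← θ_neg]; congr 1; ring

lemma k1_symm (τ u w : ℂ) : k1 τ u w = k1 τ w u := by
  unfold k1
  have h := θ_half_neg τ (u - w)
  rw [show -(u-w) + 1/2 + τ/2 = w - u + 1/2 + τ/2 by ring] at h
  rw [h, add_comm w u, show 2*cπ*I*u = 2*cπ*I*w + 2*cπ*I*(u-w) by ring, Complex.exp_add]
  ring

lemma k1_even (τ u w : ℂ) : k1 τ u (-w) = k1 τ u w := by
  unfold k1
  rw [← sub_eq_add_neg, sub_neg_eq_add]; ring

lemma k1_even' (τ u w : ℂ) : k1 τ (-u) w = k1 τ u w := by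
  rw [k1_symm, k1_even, k1_symm]

lemma quasi_k1 (τ w : ℂ) : Quasi τ 1 (fun u => k1 τ u w) := by
  refine ⟨fun x => ?_, fun x => ?_⟩
  · simp only [k1]
    rw [show x + 1 + w + 1/2 + τ/2 = (x + w + 1/2 + τ/2) + 1 by ring,
      show x + 1 - w + 1/2 + τ/2 = (x - w + 1/2 + τ/2) + 1 by ring, θ_add_one, θ_add_one,
      show 2*cπ*I*(x+1) = 2*cπ*I*x + 2*cπ*I by ring, Complex.exp_add, cexp_2cπI]
    ring
  · simp only [k1]
    rw [show x + τ + w + 1/2 + τ/2 = (x + w + 1/2 + τ/2) + τ by ring,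
      show x + τ - w + 1/2 + τ/2 = (x - w + 1/2 + τ/2) + τ by ring, θ_add_tau, θ_add_tau]
    have : Complex.exp (2*cπ*I*(x+τ)) * Complex.exp (-cπ*I*τ - 2*cπ*I*(x + w + 1/2 + τ/2)) *
      Complex.exp (-cπ*I*τ - 2*cπ*I*(x - w + 1/2 + τ/2)) * Complex.exp (2*cπ*I) =
      Complex.exp (-2*cπ*I*1*(2*x+τ)) * Complex.exp (2*cπ*I*x) := by
      simp only [← Complex.exp_add]; congr 1; ring
    rw [cexp_2cπI] at this
    linear_combination (θf τ (x + w + 1/2 + τ/2) * θf τ (x - w + 1/2 + τ/2)) * this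

lemma k1_diff {τ : ℂ} (hτ : 0 < τ.im) (w : ℂ) : Differentiable ℂ (fun u => k1 τ u w) := by
  have hd := θ_diff hτ
  have h1 : Differentiable ℂ fun u : ℂ => θf τ (u + w + 1/2 + τ/2) := hd.comp (by fun_prop)
  have h2 : Differentiable ℂ fun u : ℂ => θf τ (u - w + 1/2 + τ/2) := hd.comp (by fun_prop)
  unfold k1
  fun_prop

lemma k1_diff2 {τ : ℂ} (hτ : 0 < τ.im) : Differentiable ℂ (fun p : ℂ × ℂ => k1 τ p.1 p.2) := by
  have hd := θ_diff hτ
  have h1 : Differentiable ℂ fun p : ℂ × ℂ => θf τ (p.1 + p.2 + 1/2 + τ/2) :=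
    hd.comp (by fun_prop)
  have h2 : Differentiable ℂ fun p : ℂ × ℂ => θf τ (p.1 - p.2 + 1/2 + τ/2) :=
    hd.comp (by fun_prop)
  unfold k1
  fun_prop

lemma thetaSp_k1 {τ : ℂ} (hτ : 0 < τ.im) (w : ℂ) : ThetaSp τ 1 (fun u => k1 τ u w) := by
  have q := quasi_k1 τ w
  refine ⟨k1_diff hτ w, q.1, fun x => ?_, fun x => k1_even' τ x w⟩
  rw [q.2]; simp

lemma k1_conj {τ : ℂ} {t : ℝ} (hτ : τ = t * I) (u w : ℂ) :
    (starRingEnd ℂ) (k1 τ u w) = k1 τ ((starRingEnd ℂ) u) ((starRingEnd ℂ) w) := by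
  have hc : (starRingEnd ℂ) τ = -τ := by rw [hτ]; simp
  have hcp : (starRingEnd ℂ) cπ = cπ := by simp [cπ]
  unfold k1
  simp only [map_mul, ← Complex.exp_conj, θ_conj hτ, map_sub, map_add, map_div₀, hc, hcp,
    conj_I, map_one, map_ofNat]
  set a := (starRingEnd ℂ) u
  set b := (starRingEnd ℂ) w
  rw [show a + b + 1/2 + -τ/2 = a + b + 1/2 - τ/2 by ring,
    show a - b + 1/2 + -τ/2 = a - b + 1/2 - τ/2 by ring, θ_half, θ_half]
  have : Complex.exp (2*cπ*-I*a) * Complex.exp (2*cπ*I*(a+b)) * Complex.exp (2*cπ*I*(a-b)) =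
    Complex.exp (2*cπ*I*a) := by simp only [← Complex.exp_add]; congr 1; ring
  linear_combination (θf τ (a + b + 1/2 + τ/2) * θf τ (a - b + 1/2 + τ/2)) * this

lemma exp_prod (N : ℕ) (a b η : ℂ) :
    ∏ k ∈ Finset.range N, Complex.exp (a + b * ((2*(k:ℂ) - N + 1)*η)) = Complex.exp (a * N) := by
  rw [← Complex.exp_sum]
  congr 1
  rw [Finset.sum_add_distrib, ← Finset.mul_sum, ← Finset.sum_mul]
  have : ∀ n : ℕ, ∀ c : ℂ, ∑ k ∈ Finset.range n, (2*(k:ℂ) - c + 1) = n * (n - c) := by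
    intro n c
    induction n with
    | zero => simp
    | succ n ih => rw [Finset.sum_range_succ, ih]; push_cast; ring
  rw [this]
  simp; ring

lemma Kk_u (τ η : ℂ) (N : ℕ) (u w : ℂ) :
    Kk τ η N u w = ∏ k ∈ Finset.range N, k1 τ (u + (2*(k:ℂ) - N + 1)*η) w := by
  unfold Kk k1
  rw [← exp_prod N (2*cπ*I*u) (2*cπ*I) η, ← Finset.prod_mul_distrib]
  apply Finset.prod_congr rfl; intro k _
  congr 1
  · congr 1; ring
  · congr 2 <;> ring

lemma refl_prod (N : ℕ) (η : ℂ) (F : ℂ → ℂ) :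
    ∏ k ∈ Finset.range N, F (-((2*(k:ℂ) - N + 1)*η)) =
      ∏ k ∈ Finset.range N, F ((2*(k:ℂ) - N + 1)*η) := by
  rw [← Finset.prod_range_reflect (fun k : ℕ => F ((2*(k:ℂ) - N + 1)*η)) N]
  apply Finset.prod_congr rfl
  intro k hk
  have hk' : k + 1 ≤ N := Finset.mem_range.1 hk
  have e : ((N - 1 - k : ℕ) : ℂ) = N - 1 - k := by
    rw [Nat.sub_sub, Nat.cast_sub (by omega)]; push_cast; ring
  rw [e]; congr 1; ring

lemma Kk_w (τ η : ℂ) (N : ℕ) (u w : ℂ) :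
    Kk τ η N u w = ∏ k ∈ Finset.range N, k1 τ u (w + (2*(k:ℂ) - N + 1)*η) := by
  unfold Kk k1
  rw [Finset.prod_mul_distrib, Finset.prod_mul_distrib, Finset.prod_mul_distrib,
    ← refl_prod N η (fun d => θf τ (u - w + d + 1/2 + τ/2))]
  congr 1
  · rw [Finset.prod_const, Finset.card_range, ← Complex.exp_nat_mul]; congr 1; ring
  · congr 1
    · apply Finset.prod_congr rfl; intro k _; congr 1; ring
    · apply Finset.prod_congr rfl; intro k _; congr 1; ring

lemma Kk_symm (τ η : ℂ) (N : ℕ) (u w : ℂ) : Kk τ η N u w = Kk τ η N w u := by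
  rw [Kk_u, Kk_w]
  exact Finset.prod_congr rfl fun k _ => k1_symm _ _ _

lemma Kk_even' (τ η : ℂ) (N : ℕ) (u w : ℂ) : Kk τ η N (-u) w = Kk τ η N u w := by
  rw [Kk_w, Kk_w]
  exact Finset.prod_congr rfl fun k _ => k1_even' _ _ _

lemma Kk_even (τ η : ℂ) (N : ℕ) (u w : ℂ) : Kk τ η N u (-w) = Kk τ η N u w := by
  rw [Kk_symm, Kk_even', Kk_symm]

lemma quasi_prod (τ : ℂ) (n : ℕ) (F : ℕ → ℂ → ℂ) (h : ∀ k, Quasi τ 1 (F k)) :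
    Quasi τ n (fun u => ∏ k ∈ Finset.range n, F k u) := by
  induction n with
  | zero => exact ⟨fun x => by simp, fun x => by simp⟩
  | succ n ih =>
    have := ih.mul (h n)
    push_cast
    simpa only [Finset.prod_range_succ] using this

lemma quasi_Kk (τ η : ℂ) (N : ℕ) (w : ℂ) : Quasi τ N (fun u => Kk τ η N u w) := by
  simp only [Kk_w]
  exact quasi_prod τ N _ fun k => quasi_k1 τ _

lemma quasi_Kk' (τ η : ℂ) (N : ℕ) (u : ℂ) : Quasi τ N (fun w => Kk τ η N u w) := by
  simp only [Kk_symm τ η N u]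
  exact quasi_Kk τ η N u

lemma Kk_diff2 {τ : ℂ} (hτ : 0 < τ.im) (η : ℂ) (N : ℕ) :
    Differentiable ℂ (fun p : ℂ × ℂ => Kk τ η N p.1 p.2) := by
  simp only [Kk_w]
  have : ∀ n : ℕ, Differentiable ℂ (fun p : ℂ × ℂ => ∏ k ∈ Finset.range n,
      k1 τ p.1 (p.2 + (2*(k:ℂ) - N + 1)*η)) := by
    intro n
    induction n with
    | zero => simp
    | succ n ih =>
      simp only [Finset.prod_range_succ]
      exact ih.fun_mul ((k1_diff2 hτ).comp
        (by fun_prop : Differentiable ℂ fun p : ℂ × ℂ => (p.1, p.2 + (2*(n:ℂ) - N + 1)*η)))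
  exact this N

lemma Kk_diff {τ : ℂ} (hτ : 0 < τ.im) (η : ℂ) (N : ℕ) (w : ℂ) :
    Differentiable ℂ (fun u => Kk τ η N u w) :=
  (Kk_diff2 hτ η N).comp (by fun_prop : Differentiable ℂ fun u : ℂ => (u, w))

lemma thetaSp_Kk {τ : ℂ} (hτ : 0 < τ.im) (η : ℂ) (N : ℕ) (w : ℂ) :
    ThetaSp τ N (fun u => Kk τ η N u w) :=
  ⟨Kk_diff hτ η N w, (quasi_Kk τ η N w).1, (quasi_Kk τ η N w).2, fun x => Kk_even' τ η N x w⟩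

lemma Kk_succ_u (τ η : ℂ) (m : ℕ) (u w : ℂ) :
    Kk τ η (m+1) u w = Kk τ η m (u - η) w * k1 τ (u + m*η) w := by
  rw [Kk_u, Kk_u, Finset.prod_range_succ]
  congr 1
  · apply Finset.prod_congr rfl; intro k _; congr 1; push_cast; ring
  · congr 1; push_cast; ring

lemma Kk_succ_w (τ η : ℂ) (m : ℕ) (u w : ℂ) :
    Kk τ η (m+1) u w = Kk τ η m u (w - η) * k1 τ u (w + m*η) := by
  rw [Kk_symm, Kk_succ_u, k1_symm, Kk_symm]

lemma Mw_eq (τ η : ℂ) (N : ℕ) (u w : ℂ) :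
    Mw τ η N u w = θf τ (2*u) * θf τ (2*w) / Kk τ η (N+2) u w := by
  unfold Mw Kk
  congr 2
  · push_cast; rfl
  · apply Finset.prod_congr rfl; intro k _; congr 2 <;> · push_cast; ring

lemma Kk_conj {τ : ℂ} {t : ℝ} (hτ : τ = t * I) {η : ℂ}
    (hη : (starRingEnd ℂ) η = η ∨ (starRingEnd ℂ) η = -η) (N : ℕ) (u v : ℂ) :
    (starRingEnd ℂ) (Kk τ η N u ((starRingEnd ℂ) v)) = Kk τ η N ((starRingEnd ℂ) u) v := by
  rw [Kk_w, Kk_w, map_prod]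
  simp only [k1_conj hτ, map_add, map_mul, map_sub, Complex.conj_conj, map_natCast, map_one,
    map_ofNat]
  rcases hη with h | h
  · rw [h]
  · rw [h, ← refl_prod N η (fun d => k1 τ ((starRingEnd ℂ) u) (v + d))]
    apply Finset.prod_congr rfl; intro k _; congr 1; ring

lemma Kk_ne {τ : ℂ} {t : ℝ} (ht : 0 < t) (hτ : τ = t * I) (η : ℂ) (m : ℕ) (u w : ℂ)
    (h1 : |(u + w).im| + m * |η.im| < t/2) (h2 : |(u - w).re| + m * |η.re| < 1/2) :
    Kk τ η (m+1) u w ≠ 0 := by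
  unfold Kk
  refine mul_ne_zero (Complex.exp_ne_zero _) (Finset.prod_ne_zero_iff.2 fun k hk => ?_)
  have hk' : k ≤ m := Nat.lt_succ_iff.1 (Finset.mem_range.1 hk)
  have hkm : (k:ℝ) ≤ m := by exact_mod_cast hk'
  have hk0 : (0:ℝ) ≤ k := Nat.cast_nonneg k
  have hr : (2*(k:ℂ) - ((m+1:ℕ):ℂ) + 1) = ((2*(k:ℝ) - m : ℝ) : ℂ) := by push_cast; ring
  rw [hr]
  set r : ℝ := 2*(k:ℝ) - m with hrd
  have hrm : |r| ≤ m := abs_le.2 ⟨by rw [hrd]; linarith, by rw [hrd]; linarith⟩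
  have b1 : |r * η.im| ≤ m * |η.im| := by rw [abs_mul]; gcongr
  have b2 : |r * η.re| ≤ m * |η.re| := by rw [abs_mul]; gcongr
  have hti : τ.im = t := by rw [hτ]; simp
  have htr : τ.re = 0 := by rw [hτ]; simp
  have c1 := abs_le.1 b1
  have c2 := abs_le.1 b2
  have d1 := abs_lt.1 (lt_of_le_of_lt (le_add_of_nonneg_right (by positivity)) h1)
  have d1' := abs_le.1 (le_refl |(u+w).im|)
  have d2' := abs_le.1 (le_refl |(u-w).re|)
  refine mul_ne_zero (θ_ne_im ht hτ ?_ ?_) (θ_ne_re ht hτ ?_ ?_)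
  · have : (u + w + (r:ℂ) * η + 1/2 + τ/2).im = (u+w).im + r * η.im + t/2 := by
      simp [hti]
    rw [this]; linarith
  · have : (u + w + (r:ℂ) * η + 1/2 + τ/2).im = (u+w).im + r * η.im + t/2 := by
      simp [hti]
    rw [this]; linarith
  · have : (u - w + (r:ℂ) * η + 1/2 + τ/2).re = (u-w).re + r * η.re + 1/2 := by
      simp [htr]
    rw [this]; linarith
  · have : (u - w + (r:ℂ) * η + 1/2 + τ/2).re = (u-w).re + r * η.re + 1/2 := by
      simp [htr]
    rw [this]; linarith

lemma quasi_H {τ m : ℂ} {f : ℂ → ℂ} (hf : Quasi τ m f) (η v : ℂ) :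
    Quasi τ (m+1) (fun s => θf τ (s - m*η + v) * θf τ (s - m*η - v) * f (s + η)) := by
  refine ⟨fun x => ?_, fun x => ?_⟩
  · beta_reduce
    rw [show x + 1 - m*η + v = x - m*η + v + 1 by ring, show x + 1 - m*η - v = x - m*η - v + 1 by ring,
      show x + 1 + η = x + η + 1 by ring, θ_add_one, θ_add_one, hf.1]
    ring
  · beta_reduce
    rw [show x + τ - m*η + v = x - m*η + v + τ by ring, show x + τ - m*η - v = x - m*η - v + τ by ring,
      show x + τ + η = x + η + τ by ring, θ_add_tau, θ_add_tau, hf.2]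
    have : Complex.exp (-cπ*I*τ - 2*cπ*I*(x - m*η + v)) * Complex.exp (-cπ*I*τ - 2*cπ*I*(x - m*η - v)) *
      Complex.exp (-2*cπ*I*m*(2*(x+η)+τ)) = Complex.exp (-2*cπ*I*(m+1)*(2*x+τ)) := by
      simp only [← Complex.exp_add]; congr 1; ring
    rw [← this]; ring

/-- the function H -/
def Hf (τ η v : ℂ) (N : ℕ) (f : ℂ → ℂ) (s : ℂ) : ℂ :=
  θf τ (s - N*η + v) * θf τ (s - N*η - v) * f (s + η)

lemma Hf_diff {τ : ℂ} (hτ : 0 < τ.im) (η v : ℂ) (N : ℕ) {f : ℂ → ℂ} (hf : Differentiable ℂ f) :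
    Differentiable ℂ (Hf τ η v N f) := by
  have hd := θ_diff hτ
  have h1 : Differentiable ℂ fun s : ℂ => θf τ (s - N*η + v) := hd.comp (by fun_prop)
  have h2 : Differentiable ℂ fun s : ℂ => θf τ (s - N*η - v) := hd.comp (by fun_prop)
  have h3 : Differentiable ℂ fun s : ℂ => f (s + η) := hf.comp (by fun_prop)
  unfold Hf
  fun_prop

lemma D_exists {τ : ℂ} (hτ : 0 < τ.im) (η v : ℂ) (n : ℕ) {f : ℂ → ℂ} (hf : ThetaSp τ (n+1) f) :
    ∃ g, ThetaSp τ n g ∧ ∀ s, θf τ (2*s) * g s = Hf τ η v (n+1) f s - Hf τ η v (n+1) f (-s) := by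
  have hH := Hf_diff hτ η v (n+1) hf.1
  have qH : Quasi τ ((n+2 : ℕ) : ℂ) (Hf τ η v (n+1) f) := by
    have := quasi_H hf.quasi η v
    have e : ((n+2:ℕ):ℂ) = ((n+1:ℕ):ℂ) + 1 := by push_cast; ring
    rw [e]; exact this
  have qF := qH.sub qH.neg
  obtain ⟨g, gd, gq, ge, hg⟩ := quot_theta (τ := τ) (a := 2) (b := n) (σ := -1)
    (F := fun s => Hf τ η v (n+1) f s - Hf τ η v (n+1) f (-s)) (simp_θ2 hτ)
    (by have : Differentiable ℂ fun s => Hf τ η v (n+1) f (-s) := hH.comp (by fun_prop)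
        fun_prop)
    (fun z hz => odd_zero hτ qF (fun x => by rw [neg_neg]; ring) hz) (quasi_θ2 τ)
    (by convert qF using 1; push_cast; ring) (by norm_num)
    (fun x => by rw [mul_neg, θ_neg]; ring) (fun x => by rw [neg_neg]; ring)
  exact ⟨g, ⟨gd, gq.1, gq.2, ge⟩, hg⟩

lemma Hf_cancel (τ η v : ℂ) (N : ℕ) (f : ℂ → ℂ) (hf : ∀ x, f (-x) = f x) (s : ℂ) :
    Hf τ η v N f (-s) = θf τ (s + N*η + v) * θf τ (s + N*η - v) * f (s - η) := by
  unfold Hf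
  rw [show -s - N*η + v = -(s + N*η - v) by ring, show -s - N*η - v = -(s + N*η + v) by ring,
    θ_neg, θ_neg, show -s + η = -(s - η) by ring, hf]
  ring

/-- D evaluated at the special point -/
lemma D_special {τ : ℂ} (η v : ℂ) (n : ℕ) {f g : ℂ → ℂ} (hf : ∀ x, f (-x) = f x)
    (hg : ∀ s, θf τ (2*s) * g s = Hf τ η (v + n*η) (n+1) f s - Hf τ η (v + n*η) (n+1) f (-s))
    (hv : θf τ (2*v - 2*η) ≠ 0) : g (v - η) = -θf τ (2*(n+1)*η) * f v := by
  have h := hg (v - η)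
  rw [Hf_cancel _ _ _ _ _ hf] at h
  unfold Hf at h
  rw [show v - η + ((n+1:ℕ):ℂ)*η - (v + n*η) = 0 by push_cast; ring, θ_zero,
    show v - η - ((n+1:ℕ):ℂ)*η + (v + n*η) = 2*v - 2*η by push_cast; ring,
    show v - η - ((n+1:ℕ):ℂ)*η - (v + n*η) = -(2*(n+1)*η) by push_cast; ring, θ_neg,
    sub_add_cancel, mul_sub] at h
  apply mul_left_cancel₀ hv
  linear_combination h

lemma G_ident {τ : ℂ} {t : ℝ} (ht : 0 < t) (hτ : τ = t * I) (ε v w u : ℂ) :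
    Hf τ ε v 1 (fun s => k1 τ s w) u - Hf τ ε v 1 (fun s => k1 τ s w) (-u) =
      -θf τ (2*ε) * k1 τ v w * θf τ (2*u) := by
  have hti : 0 < τ.im := by rw [hτ]; simpa using ht
  have hk := thetaSp_k1 hti w
  have hs := simp_θ hti 2 (-2*ε) two_ne_zero
  have hd := θ_cont hti
  refine ext_simp hs (z := v) (h₁ := fun v => Hf τ ε v 1 (fun s => k1 τ s w) u -
    Hf τ ε v 1 (fun s => k1 τ s w) (-u)) (h₂ := fun v => -θf τ (2*ε) * k1 τ v w * θf τ (2*u)) ?_ ?_ ?_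
  · unfold Hf
    fun_prop
  · have := (k1_diff hti w).continuous
    fun_prop
  · intro v hv
    obtain ⟨g, hg, h⟩ := D_exists hti ε v 0 hk
    have h2 := D_special ε v 0 hk.2.2.2 (g := g) (by simpa using h)
      (by convert hv using 2; ring)
    have q0 : Quasi τ 0 g := by simpa using hg.quasi
    have h3 := liouville ht hτ hg.1 q0 u (v - ε)
    have h4 := h u
    rw [h3, h2] at h4
    simp only [zero_add] at h4
    rw [← h4]
    simp; ring

/-! ### Part E: contour shifts -/

lemma per_int {φ : ℝ → ℂ} {T : ℝ} (h : Function.Periodic φ T) (a : ℝ) :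
    ∫ x in (0:ℝ)..T, φ (x + a) = ∫ x in (0:ℝ)..T, φ x := by
  rw [intervalIntegral.integral_comp_add_right]
  have := h.intervalIntegral_add_eq a 0
  rw [zero_add, add_comm T a, this, zero_add]

lemma per_neg {φ : ℝ → ℂ} {T : ℝ} (h : Function.Periodic φ T) :
    ∫ x in (0:ℝ)..T, φ (-x) = ∫ x in (0:ℝ)..T, φ x := by
  rw [intervalIntegral.integral_comp_neg]
  have := h.intervalIntegral_add_eq (-T) 0
  rw [neg_add_cancel, zero_add] at this
  rw [neg_zero, this]

lemma shift1 {h : ℂ → ℂ} {T : ℝ} (hp : ∀ z, h (z + T) = h z) (a : ℂ)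
    (hd : ∀ z : ℂ, z.im ∈ Set.uIcc 0 a.im → DifferentiableAt ℂ h z) :
    ∫ x in (0:ℝ)..T, h (x + a) = ∫ x in (0:ℝ)..T, h x := by
  have e1 : ∫ x in (0:ℝ)..T, h (x + a) = ∫ x in (0:ℝ)..T, h (x + a.im * I) := by
    have hper : Function.Periodic (fun x : ℝ => h (x + a.im * I)) T := by
      intro x
      beta_reduce
      rw [← hp (x + a.im * I)]; congr 1; push_cast; ring
    rw [← per_int hper a.re]
    congr 1; funext x
    congr 1
    conv_lhs => rw [← Complex.re_add_im a]
    push_cast; ring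
  rw [e1]
  have := Complex.integral_boundary_rect_eq_zero_of_differentiableOn h 0 (T + a.im * I)
    (fun z hz => (hd z (by simpa using hz.2)).differentiableWithinAt)
  simp at this
  have e2 : ∀ y : ℝ, h (T + y * I) = h (y * I) := by
    intro y; rw [← hp (y * I), add_comm]
  simp only [e2] at this
  linear_combination -this

/-- the double integral over a fundamental domain -/
def dint (t : ℝ) (Φ : ℂ → ℂ → ℂ) : ℂ :=
  ∫ y in (0:ℝ)..t, ∫ x in (0:ℝ)..(1:ℝ), Φ (x + y*I) (x - y*I)

/-- doubly periodic in each variable -/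
structure Per2 (τ : ℂ) (Φ : ℂ → ℂ → ℂ) : Prop where
  u1 : ∀ u w, Φ (u + 1) w = Φ u w
  ut : ∀ u w, Φ (u + τ) w = Φ u w
  w1 : ∀ u w, Φ u (w + 1) = Φ u w
  wt : ∀ u w, Φ u (w + τ) = Φ u w

lemma Per2.perx {τ : ℂ} {Φ : ℂ → ℂ → ℂ} (h : Per2 τ Φ) (a b z : ℂ) :
    Φ (z + 1 + a) (z + 1 + b) = Φ (z + a) (z + b) := by
  rw [show z + 1 + a = z + a + 1 by ring, show z + 1 + b = z + b + 1 by ring, h.u1, h.w1]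

lemma Per2.pery {τ : ℂ} {t : ℝ} (hτ : τ = t * I) {Φ : ℂ → ℂ → ℂ} (h : Per2 τ Φ) (a b z : ℂ) :
    Φ (a + (z + t) * I) (b - (z + t) * I) = Φ (a + z * I) (b - z * I) := by
  have h2 := h.wt (a + z * I) (b - (z + t) * I)
  rw [show b - (z + t) * I + τ = b - z * I by rw [hτ]; ring] at h2
  rw [h2, show a + (z + t) * I = a + z * I + τ by rw [hτ]; ring, h.ut]

lemma dint_neg {τ : ℂ} {t : ℝ} (hτ : τ = t * I) {Φ : ℂ → ℂ → ℂ} (h : Per2 τ Φ) :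
    dint t (fun u w => Φ (-u) (-w)) = dint t Φ := by
  unfold dint
  have hx : ∀ y : ℝ, ∫ x in (0:ℝ)..(1:ℝ), Φ (-(x + y*I)) (-(x - y*I)) =
      ∫ x in (0:ℝ)..(1:ℝ), Φ (x + (-y : ℝ)*I) (x - (-y:ℝ)*I) := by
    intro y
    have hp : Function.Periodic (fun x : ℝ => Φ (x + (-y : ℝ)*I) (x - (-y:ℝ)*I)) 1 := by
      intro x
      have := h.perx ((-y:ℝ)*I) (-((-y:ℝ)*I)) x
      simpa only [ofReal_add, ofReal_one, ← sub_eq_add_neg] using this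
    rw [← per_neg hp]
    congr 1; funext x
    congr 1 <;> · push_cast; ring
  simp only [hx]
  have hp : Function.Periodic (fun y : ℝ => ∫ x in (0:ℝ)..(1:ℝ), Φ (x + y*I) (x - y*I)) t := by
    intro y
    beta_reduce
    congr 1; funext x
    have := h.pery hτ x x y
    push_cast
    exact this
  exact per_neg hp

lemma dint_shift {τ : ℂ} {t : ℝ} (hτ : τ = t * I) {Φ : ℂ → ℂ → ℂ} (h : Per2 τ Φ) (η : ℂ)
    (hd : ∀ u w : ℂ, |(u + w).im| ≤ |η.im| → |(u - w).re| ≤ |η.re| →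
      DifferentiableAt ℂ (fun p : ℂ × ℂ => Φ p.1 p.2) (u, w)) :
    dint t (fun u w => Φ (u - η) w) = dint t Φ := by
  unfold dint
  -- first shift in x
  have hx : ∀ y : ℝ, ∫ x in (0:ℝ)..(1:ℝ), Φ (x + y*I) (x - y*I) =
      ∫ x in (0:ℝ)..(1:ℝ), Φ (x - η/2 + y*I) (x - η/2 - y*I) := by
    intro y
    have := shift1 (h := fun z : ℂ => Φ (z + y*I) (z - y*I)) (T := 1) (fun z => by
      have := h.perx (y*I) (-(y*I)) z
      simpa only [ofReal_one, ← sub_eq_add_neg] using this) (-(η/2)) (fun z hz => by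
        refine DifferentiableAt.comp z (g := fun p : ℂ × ℂ => Φ p.1 p.2)
          (f := fun z : ℂ => (z + y*I, z - y*I)) (hd _ _ ?_ ?_) (by fun_prop)
        · have e : (z + y*I + (z - y*I)).im = 2 * z.im := by simp; ring
          rw [e]
          have e2 : (-(η/2)).im = -(η.im/2) := by simp
          rw [e2, Set.mem_uIcc] at hz
          rw [abs_mul, abs_two]
          rcases hz with hz | hz
          · rw [abs_of_nonneg hz.1, abs_of_nonpos (by linarith : η.im ≤ 0)]; linarith
          · rw [abs_of_nonpos hz.2, abs_of_nonneg (by linarith : 0 ≤ η.im)]; linarith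
        · have e : (z + y*I - (z - y*I)).re = 0 := by simp
          rw [e, abs_zero]; exact abs_nonneg _)
    rw [← this]
    simp only [sub_eq_add_neg]
  simp only [hx]
  -- continuity
  have cc : ∀ u0 w0 : ℂ, |(u0 + w0).im| ≤ |η.im| → |(u0 - w0).re| ≤ |η.re| →
      Continuous (fun p : ℝ × ℝ => Φ (p.2 + u0 + p.1*I) (p.2 + w0 - p.1*I)) := by
    intro u0 w0 h1 h2
    rw [continuous_iff_continuousAt]
    intro p
    refine ContinuousAt.comp (g := fun p : ℂ × ℂ => Φ p.1 p.2)
          (f := fun p : ℝ × ℝ => ((p.2 + u0 + p.1*I : ℂ), (p.2 + w0 - p.1*I : ℂ)))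
          (hd _ _ ?_ ?_).continuousAt (by fun_prop)
    · have e : (p.2 + u0 + p.1*I + (p.2 + w0 - p.1*I)).im = (u0 + w0).im := by simp
      rw [e]; exact h1
    · have e : (p.2 + u0 + p.1*I - (p.2 + w0 - p.1*I)).re = (u0 - w0).re := by simp
      rw [e]; exact h2
  have sw : ∀ u0 w0 : ℂ, |(u0 + w0).im| ≤ |η.im| → |(u0 - w0).re| ≤ |η.re| →
      ∫ y in (0:ℝ)..t, ∫ x in (0:ℝ)..(1:ℝ), Φ (x + u0 + y*I) (x + w0 - y*I) =
      ∫ x in (0:ℝ)..(1:ℝ), ∫ y in (0:ℝ)..t, Φ (x + u0 + y*I) (x + w0 - y*I) := by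
    intro u0 w0 h1 h2
    apply intervalIntegral_intervalIntegral_swap (F := fun y x : ℝ => Φ (x + u0 + y*I) (x + w0 - y*I))
    have := ((cc u0 w0 h1 h2).continuousOn (s := Set.uIcc 0 t ×ˢ Set.uIcc 0 1)).integrableOn_compact
      (μ := volume) (isCompact_uIcc.prod isCompact_uIcc)
    exact this.mono_set (Set.prod_mono Set.uIoc_subset_uIcc Set.uIoc_subset_uIcc)
  have s1 := sw (-(η/2)) (-(η/2)) (by
    have e : (-(η/2) + -(η/2)).im = -η.im := by rw [← neg_add, add_halves]; simp
    rw [e, abs_neg]) (by simp)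
  have s2 := sw (-η) 0 (by simp) (by simp)
  have hy : ∀ x : ℝ, ∫ y in (0:ℝ)..t, Φ (x + -(η/2) + y*I) (x + -(η/2) - y*I) =
      ∫ y in (0:ℝ)..t, Φ (x + -η + y*I) (x + 0 - y*I) := by
    intro x
    have := shift1 (h := fun z : ℂ => Φ (x + -(η/2) + z*I) (x + -(η/2) - z*I)) (T := t)
      (fun z => h.pery hτ _ _ z) (I * η/2) (fun z hz => by
        refine DifferentiableAt.comp z (g := fun p : ℂ × ℂ => Φ p.1 p.2)
          (f := fun z : ℂ => (x + -(η/2) + z*I, x + -(η/2) - z*I)) (hd _ _ ?_ ?_) (by fun_prop)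
        · have e : (x + -(η/2) + z*I + (x + -(η/2) - z*I)).im = -η.im := by simp; ring
          rw [e, abs_neg]
        · have e : (x + -(η/2) + z*I - (x + -(η/2) - z*I)).re = -2 * z.im := by simp; ring
          rw [e]
          have e2 : (I * η/2).im = η.re/2 := by simp
          rw [e2, Set.mem_uIcc] at hz
          rw [abs_mul, abs_neg, abs_two]
          rcases hz with hz | hz
          · rw [abs_of_nonneg hz.1, abs_of_nonneg (by linarith : 0 ≤ η.re)]; linarith
          · rw [abs_of_nonpos hz.2, abs_of_nonpos (by linarith : η.re ≤ 0)]; linarith)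
    rw [← this]
    congr 1; funext y
    congr 1
    · linear_combination (-(η/2)) * I_sq * (-1)
    · linear_combination (-η/2) * I_sq
  simp only [hy] at s1
  rw [← s2] at s1
  simp only [add_zero] at s1
  simp only [sub_eq_add_neg] at s1 ⊢
  rw [s1]
  congr 1; funext y
  congr 1; funext x
  congr 1; ring

/-! ### Part F: the adjoint relation -/

lemma dint_congr {t : ℝ} {Φ Ψ : ℂ → ℂ → ℂ}
    (h : ∀ x y : ℝ, Φ (x + y*I) (x - y*I) = Ψ (x + y*I) (x - y*I)) : dint t Φ = dint t Ψ := by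
  unfold dint
  simp only [h]

lemma dint_add {t : ℝ} {Φ Ψ : ℂ → ℂ → ℂ}
    (h1 : Continuous fun p : ℝ × ℝ => Φ (p.2 + p.1*I) (p.2 - p.1*I))
    (h2 : Continuous fun p : ℝ × ℝ => Ψ (p.2 + p.1*I) (p.2 - p.1*I)) :
    dint t (fun u w => Φ u w + Ψ u w) = dint t Φ + dint t Ψ := by
  unfold dint
  have c1 : ∀ y : ℝ, Continuous fun x : ℝ => Φ (x + y*I) (x - y*I) := fun y =>
    h1.comp (by fun_prop : Continuous fun x : ℝ => (y, x))
  have c2 : ∀ y : ℝ, Continuous fun x : ℝ => Ψ (x + y*I) (x - y*I) := fun y =>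
    h2.comp (by fun_prop : Continuous fun x : ℝ => (y, x))
  have e : ∀ y : ℝ, ∫ x in (0:ℝ)..(1:ℝ), (Φ (x + y*I) (x - y*I) + Ψ (x + y*I) (x - y*I)) =
     (∫ x in (0:ℝ)..(1:ℝ), Φ (x + y*I) (x - y*I)) + ∫ x in (0:ℝ)..(1:ℝ), Ψ (x + y*I) (x - y*I) :=
    fun y => intervalIntegral.integral_add ((c1 y).intervalIntegrable _ _)
      ((c2 y).intervalIntegrable _ _)
  simp only [e]
  have d1 := intervalIntegral.continuous_parametric_intervalIntegral_of_continuous' (μ := volume)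
    (f := fun y x : ℝ => Φ (x + y*I) (x - y*I)) h1 0 1
  have d2 := intervalIntegral.continuous_parametric_intervalIntegral_of_continuous' (μ := volume)
    (f := fun y x : ℝ => Ψ (x + y*I) (x - y*I)) h2 0 1
  exact intervalIntegral.integral_add (d1.intervalIntegrable _ _) (d2.intervalIntegrable _ _)

lemma dint_smul {t : ℝ} (c : ℂ) (Φ : ℂ → ℂ → ℂ) :
    dint t (fun u w => c * Φ u w) = c * dint t Φ := by
  unfold dint
  simp only [intervalIntegral.integral_const_mul]

lemma dint_main {τ : ℂ} {t : ℝ} (hτ : τ = t * I) {Φ : ℂ → ℂ → ℂ} (h : Per2 τ Φ) (η : ℂ)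
    (hd : ∀ u w : ℂ, |(u + w).im| ≤ |η.im| → |(u - w).re| ≤ |η.re| →
      DifferentiableAt ℂ (fun p : ℂ × ℂ => Φ p.1 p.2) (u, w)) :
    dint t (fun u w => Φ u w + Φ (-u) (-w)) =
      dint t (fun u w => Φ (u - η) w + Φ (-u - η) (-w)) := by
  have key : ∀ (σ : ℝ) (u0 : ℂ), |u0.im| ≤ |η.im| → |u0.re| ≤ |η.re| →
      Continuous (fun p : ℝ × ℝ => Φ (σ * (p.2 + p.1*I) - u0) (σ * (p.2 - p.1*I))) := by
    intro σ u0 h1 h2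
    rw [continuous_iff_continuousAt]
    intro p
    refine ContinuousAt.comp (g := fun p : ℂ × ℂ => Φ p.1 p.2)
          (f := fun p : ℝ × ℝ => ((σ * (p.2 + p.1*I) - u0 : ℂ), (σ * (p.2 - p.1*I) : ℂ)))
          (hd _ _ ?_ ?_).continuousAt (by fun_prop)
    · have e : (σ * (p.2 + p.1*I) - u0 + σ * (p.2 - p.1*I)).im = -u0.im := by simp; ring
      rw [e, abs_neg]; exact h1
    · have e : (σ * (p.2 + p.1*I) - u0 - σ * (p.2 - p.1*I)).re = -u0.re := by simp
      rw [e, abs_neg]; exact h2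
  have k1 := key 1 0 (by simp) (by simp)
  have k2 := key (-1) 0 (by simp) (by simp)
  have k3 := key 1 η le_rfl le_rfl
  have k4 := key (-1) η le_rfl le_rfl
  simp only [ofReal_one, one_mul, sub_zero, ofReal_neg, neg_mul] at k1 k2 k3 k4
  rw [dint_add k1 (Ψ := fun u w => Φ (-u) (-w)) k2,
    dint_add (Φ := fun u w => Φ (u - η) w) k3 (Ψ := fun u w => Φ (-u - η) (-w)) k4]
  have hs : Per2 τ (fun u w => Φ (u - η) w) :=
    ⟨fun u w => by rw [show u + 1 - η = u - η + 1 by ring, h.u1],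
     fun u w => by rw [show u + τ - η = u - η + τ by ring, h.ut],
     fun u w => h.w1 _ _, fun u w => h.wt _ _⟩
  have e1 := dint_neg hτ h
  have e2 := dint_neg hτ hs
  have e3 := dint_shift hτ h η hd
  rw [e1]
  rw [e3] at e2
  rw [e2, e3]

lemma per2_quot {τ m : ℂ} {A B : ℂ → ℂ} {K : ℂ → ℂ → ℂ} (hA : Quasi τ m A) (hB : Quasi τ m B)
    (hK : ∀ w, Quasi τ m (fun u => K u w)) (hK' : ∀ u, Quasi τ m (fun w => K u w)) :
    Per2 τ (fun u w => A u * B w / K u w) := by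
  refine ⟨fun u w => ?_, fun u w => ?_, fun u w => ?_, fun u w => ?_⟩
  · rw [hA.1, show K (u + 1) w = _ from (hK w).1 u]
  · rw [hA.2, show K (u + τ) w = _ from (hK w).2 u, mul_assoc, mul_div_mul_left _ _ (Complex.exp_ne_zero _)]
  · rw [hB.1, show K u (w + 1) = _ from (hK' u).1 w]
  · rw [hB.2, show K u (w + τ) = _ from (hK' u).2 w, mul_left_comm, mul_div_mul_left _ _ (Complex.exp_ne_zero _)]

lemma bil {τ : ℂ} {t : ℝ} (ht : 0 < t) (hτ : τ = t * I) (η v : ℂ) (n : ℕ)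
    (h1 : ((n:ℝ)+2) * |η.im| < t/2) (h2 : ((n:ℝ)+2) * |η.re| < 1/2)
    {f g D : ℂ → ℂ} (hf : ThetaSp τ (n+1) f) (hg : ThetaSp τ n g)
    (hD : ∀ s, θf τ (2*s) * D s = Hf τ η v (n+1) f s - Hf τ η v (n+1) f (-s)) :
    dint t (fun u w => D u * g w * Mw τ η n u w) =
      -θf τ (2*(n+2)*η) * dint t (fun u w => f u * (g w * k1 τ w v) * Mw τ η (n+1) u w) := by
  have hti : 0 < τ.im := by rw [hτ]; simpa using ht
  have hθ := θ_diff hti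
  let B : ℂ → ℂ := fun w => g w * θf τ (2*w)
  have Bd : Differentiable ℂ B := hg.1.mul (simp_θ2 hti).1
  have Bo : ∀ w, B (-w) = -B w := by
    intro w; simp only [B]; rw [hg.2.2.2, mul_neg, θ_neg]; ring
  let H := Hf τ η v (n+1) f
  have Hd : Differentiable ℂ H := Hf_diff hti η v (n+1) hf.1
  have qH : Quasi τ ((n+2 : ℕ) : ℂ) H := by
    have := quasi_H hf.quasi η v
    have e : ((n+2:ℕ):ℂ) = ((n+1:ℕ):ℂ) + 1 := by push_cast; ring
    rw [e]; exact this
  have qB : Quasi τ ((n+2 : ℕ) : ℂ) B := by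
    have := hg.quasi.mul (quasi_θ2 τ)
    have e : ((n+2:ℕ):ℂ) = (n:ℂ) + 2 := by push_cast; ring
    rw [e]; exact this
  have hP := per2_quot qH qB (quasi_Kk τ η (n+2)) (quasi_Kk' τ η (n+2))
  have hd : ∀ u w : ℂ, |(u + w).im| ≤ |η.im| → |(u - w).re| ≤ |η.re| →
      DifferentiableAt ℂ (fun p : ℂ × ℂ => H p.1 * B p.2 / Kk τ η (n+2) p.1 p.2) (u, w) := by
    intro u w a1 a2
    have hne : Kk τ η (n+2) u w ≠ 0 := by
      apply Kk_ne ht hτ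
      · push_cast; linarith
      · push_cast; linarith
    have dH : Differentiable ℂ fun p : ℂ × ℂ => H p.1 := Hd.comp (by fun_prop)
    have dB : Differentiable ℂ fun p : ℂ × ℂ => B p.2 := Bd.comp (by fun_prop)
    have dK := Kk_diff2 hti η (n+2)
    have di : DifferentiableAt ℂ (fun p : ℂ × ℂ => (Kk τ η (n+2) p.1 p.2)⁻¹) (u, w) :=
      (differentiableAt_inv (x := Kk τ η (n+2) u w) hne).comp (u, w) (dK (u, w))
    simp only [div_eq_mul_inv]
    exact ((dH _).fun_mul (dB _)).fun_mul di
  have M := dint_main hτ hP η hd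
  rw [← dint_smul]
  refine Eq.trans (dint_congr fun x y => ?_) (M.trans (dint_congr fun x y => ?_))
  · rw [Mw_eq, Kk_even, Kk_even', Bo]
    have := hD (x + y*I)
    simp only [B, H]
    linear_combination (g (x - y*I) * θf τ (2*(x - y*I)) / Kk τ η (n+2) (x + y*I) (x - y*I)) * this
  · set u : ℂ := x + y*I with hu
    set w : ℂ := x - y*I with hw
    have hne : Kk τ η (n+3) u w ≠ 0 := by
      apply Kk_ne ht hτ
      · have e : (u + w).im = 0 := by simp [hu, hw]
        rw [e, abs_zero, zero_add]; push_cast; exact h1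
      · have e : (u - w).re = 0 := by simp [hu, hw]
        rw [e, abs_zero, zero_add]; push_cast; exact h2
    have e1 := Kk_succ_u τ η (n+2) u w
    have e2 := Kk_succ_u τ η (n+2) (-u) w
    rw [Kk_even'] at e2
    have G := G_ident ht hτ ((n+2)*η) v w u
    rw [Mw_eq, Kk_even, Bo]
    have n1 := hne
    have n2 := hne
    rw [e1] at n1
    rw [e2] at n2
    have n1a := left_ne_zero_of_mul n1
    have n1b := right_ne_zero_of_mul n1
    have n2a := left_ne_zero_of_mul n2
    have n2b := right_ne_zero_of_mul n2
    have q1 : H (u - η) / Kk τ η (n+2) (u - η) w =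
        f u * Hf τ ((n+2)*η) v 1 (fun s => k1 τ s w) u / Kk τ η (n+3) u w := by
      rw [e1, div_eq_div_iff n1a n1]
      simp only [H, Hf]
      rw [show u - η - ((n+1:ℕ):ℂ)*η = u - ((1:ℕ):ℂ)*((n+2)*η) by push_cast; ring, sub_add_cancel,
        show ((n+2:ℕ):ℂ)*η = (n+2)*η by push_cast; ring]
      ring
    have q2 : H (-u - η) / Kk τ η (n+2) (-u - η) w =
        f u * Hf τ ((n+2)*η) v 1 (fun s => k1 τ s w) (-u) / Kk τ η (n+3) u w := by
      rw [e2, div_eq_div_iff n2a n2]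
      simp only [H, Hf]
      rw [show -u - η - ((n+1:ℕ):ℂ)*η = -u - ((1:ℕ):ℂ)*((n+2)*η) by push_cast; ring, sub_add_cancel,
        show ((n+2:ℕ):ℂ)*η = (n+2)*η by push_cast; ring, hf.2.2.2]
      ring
    have e0 : H (u - η) * B w / Kk τ η (n+2) (u - η) w + H (-u - η) * -B w / Kk τ η (n+2) (-u - η) w
      = B w * (H (u - η) / Kk τ η (n+2) (u - η) w - H (-u - η) / Kk τ η (n+2) (-u - η) w) := by ring
    rw [e0, q1, q2, ← sub_div, ← mul_sub, G, k1_symm τ v w, ← mul_assoc 2 ((n:ℂ)+2) η]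
    simp only [B]
    rw [show n + 1 + 2 = n + 3 by ring]
    ring

/-! ### Part G: the base case -/

lemma k1_alt (τ s w : ℂ) : k1 τ s w = Complex.exp (2*cπ*I*(w + 1/2 + τ/2) - cπ*I*τ) *
    (θf τ (s + (w + 1/2 + τ/2)) * θf τ (s - (w + 1/2 + τ/2))) := by
  unfold k1
  rw [show s - w + 1/2 + τ/2 = s - (w + 1/2 + τ/2) + τ + 1 by ring, θ_add_one, θ_add_tau,
    show s + w + 1/2 + τ/2 = s + (w + 1/2 + τ/2) by ring,
    show 2*cπ*I*(w + 1/2 + τ/2) - cπ*I*τ = 2*cπ*I*s + (-cπ*I*τ - 2*cπ*I*(s - (w + 1/2 + τ/2))) by ring,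
    Complex.exp_add]
  ring

/-- Weierstrass three term identity -/
lemma weier {τ : ℂ} {t : ℝ} (ht : 0 < t) (hτ : τ = t * I) (u v x ε : ℂ) :
    θf τ (u - ε + v) * θf τ (u - ε - v) * (θf τ (u + ε + x) * θf τ (u + ε - x)) -
    θf τ (u + ε + v) * θf τ (u + ε - v) * (θf τ (u - ε + x) * θf τ (u - ε - x)) =
    -θf τ (2*ε) * θf τ (2*u) * (θf τ (v + x) * θf τ (v - x)) := by
  have h := G_ident ht hτ ε v (x - 1/2 - τ/2) u
  rw [Hf_cancel _ _ _ _ _ (fun s => k1_even' τ s _)] at h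
  unfold Hf at h
  simp only [k1_alt, Nat.cast_one, one_mul, show x - 1/2 - τ/2 + 1/2 + τ/2 = x by ring] at h
  apply mul_left_cancel₀ (Complex.exp_ne_zero (2*cπ*I*x - cπ*I*τ))
  linear_combination h

lemma weier_deriv {τ : ℂ} {t : ℝ} (ht : 0 < t) (hτ : τ = t * I) (u v x : ℂ) :
    (deriv (θf τ) (u + v) * θf τ (u - v) + θf τ (u + v) * deriv (θf τ) (u - v)) *
      (θf τ (u + x) * θf τ (u - x)) -
    (θf τ (u + v) * θf τ (u - v)) *
      (deriv (θf τ) (u + x) * θf τ (u - x) + θf τ (u + x) * deriv (θf τ) (u - x)) =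
    deriv (θf τ) 0 * θf τ (2*u) * (θf τ (v + x) * θf τ (v - x)) := by
  have hti : 0 < τ.im := by rw [hτ]; simpa using ht
  have hθ := θ_diff hti
  have hm : ∀ v : ℂ, HasDerivAt (fun ε => θf τ (u - ε + v)) (-deriv (θf τ) (u + v)) 0 := by
    intro v
    have h1 : HasDerivAt (fun ε : ℂ => u - ε + v) (-1) 0 := by
      simpa using ((hasDerivAt_id (0:ℂ)).const_sub u).add_const v
    have h2 := (hθ (u - 0 + v)).hasDerivAt.comp 0 h1
    simpa [Function.comp_def] using h2
  have hp : ∀ v : ℂ, HasDerivAt (fun ε => θf τ (u + ε + v)) (deriv (θf τ) (u + v)) 0 := by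
    intro v
    have h1 : HasDerivAt (fun ε : ℂ => u + ε + v) 1 0 := by
      simpa using ((hasDerivAt_id (0:ℂ)).const_add u).add_const v
    have h2 := (hθ (u + 0 + v)).hasDerivAt.comp 0 h1
    simpa [Function.comp_def] using h2
  have h2 : HasDerivAt (fun ε => θf τ (2*ε)) (deriv (θf τ) 0 * 2) 0 := by
    have h1 : HasDerivAt (fun ε : ℂ => 2*ε) 2 0 := by
      simpa using (hasDerivAt_id (0:ℂ)).const_mul 2
    have h2 := HasDerivAt.comp (h₂ := θf τ) (h₂' := deriv (θf τ) 0) 0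
      (by rw [mul_zero]; exact (hθ 0).hasDerivAt) h1
    exact h2
  have A := (((hm v).mul (hm (-v))).mul ((hp x).mul (hp (-x)))).sub
    (((hp v).mul (hp (-v))).mul ((hm x).mul (hm (-x))))
  have B := (h2.const_mul (-1)).mul_const (θf τ (2*u) * (θf τ (v + x) * θf τ (v - x)))
  have e : (fun ε => -1 * θf τ (2*ε) * (θf τ (2*u) * (θf τ (v + x) * θf τ (v - x)))) =
     (fun ε => θf τ (u - ε + v) * θf τ (u - ε + -v) * (θf τ (u + ε + x) * θf τ (u + ε + -x)) -
    θf τ (u + ε + v) * θf τ (u + ε + -v) * (θf τ (u - ε + x) * θf τ (u - ε + -x))) := by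
    funext ε
    have := weier ht hτ u v x ε
    simp only [← sub_eq_add_neg]
    linear_combination -this
  rw [e] at B
  have C := A.unique B
  simp only [Pi.mul_apply, sub_zero, add_zero, ← sub_eq_add_neg] at C
  linear_combination (-1/2) * C

/-- logarithmic derivative of theta -/
def Ld (τ z : ℂ) : ℂ := deriv (θf τ) z / θf τ z

lemma deriv_θ_add_one (τ z : ℂ) : deriv (θf τ) (z + 1) = -deriv (θf τ) z := by
  have e : (fun x => θf τ (x + 1)) = fun x => -θf τ x := funext (θ_add_one τ)
  have := deriv_comp_add_const (θf τ) 1 z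
  rw [← this, e]
  exact deriv.neg

lemma deriv_θ_neg (τ z : ℂ) : deriv (θf τ) (-z) = deriv (θf τ) z := by
  have e : (fun x => θf τ (-x)) = fun x => -θf τ x := funext (θ_neg τ)
  have h := deriv_comp_neg (θf τ) z
  rw [e] at h
  have h2 : deriv (fun x => -θf τ x) z = -deriv (θf τ) z := deriv.neg
  rw [h2] at h
  exact (neg_inj.1 h).symm

lemma deriv_θ_add_tau {τ : ℂ} (hτ : 0 < τ.im) (z : ℂ) : deriv (θf τ) (z + τ) =
    -Complex.exp (-cπ*I*τ - 2*cπ*I*z) * (deriv (θf τ) z - 2*cπ*I * θf τ z) := by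
  have e : (fun x => θf τ (x + τ)) = fun x => -Complex.exp (-cπ*I*τ - 2*cπ*I*x) * θf τ x :=
    funext (θ_add_tau τ)
  have := deriv_comp_add_const (θf τ) τ z
  rw [← this, e]
  have h1 : HasDerivAt (fun x : ℂ => -Complex.exp (-cπ*I*τ - 2*cπ*I*x))
      (-(Complex.exp (-cπ*I*τ - 2*cπ*I*z) * (-(2*cπ*I)))) z := by
    have := ((((hasDerivAt_id z).const_mul (2*cπ*I)).const_sub (-cπ*I*τ)).cexp).fun_neg
    simpa using this
  have h2 := (h1.mul (θ_diff hτ z).hasDerivAt).deriv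
  refine h2.trans ?_
  ring

lemma Ld_neg (τ z : ℂ) : Ld τ (-z) = -Ld τ z := by
  unfold Ld; rw [deriv_θ_neg, θ_neg, div_neg]

lemma Ld_add_one (τ z : ℂ) : Ld τ (z + 1) = Ld τ z := by
  unfold Ld; rw [deriv_θ_add_one, θ_add_one, neg_div_neg_eq]

lemma Ld_add_tau {τ : ℂ} (hτ : 0 < τ.im) {z : ℂ} (hz : θf τ z ≠ 0) :
    Ld τ (z + τ) = Ld τ z - 2*cπ*I := by
  unfold Ld
  rw [deriv_θ_add_tau hτ, θ_add_tau, mul_div_mul_left _ _ (neg_ne_zero.2 (Complex.exp_ne_zero _))]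
  field_simp

lemma Ld_diff {τ : ℂ} (hτ : 0 < τ.im) {z : ℂ} (hz : θf τ z ≠ 0) : DifferentiableAt ℂ (Ld τ) z := by
  have h := θ_diff hτ
  exact (h.deriv z).fun_div (h z) hz

lemma θ_ne_small {τ : ℂ} {t : ℝ} (ht : 0 < t) (hτ : τ = t * I) {z : ℂ} (hz : z ≠ 0)
    (h1 : |z.re| < 1) (h2 : |z.im| < t) : θf τ z ≠ 0 := by
  intro h
  obtain ⟨m, n, hmn⟩ := θ_zeros (by simp [hτ, ht]) h
  have hr : z.re = m := by rw [hmn, hτ]; simp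
  have hi : z.im = n * t := by rw [hmn, hτ]; simp
  rw [hr] at h1
  rw [hi, abs_mul, abs_of_pos ht] at h2
  have hn : |(n:ℝ)| < 1 := by
    by_contra hc; push Not at hc; nlinarith
  have hm0 : m = 0 := by
    have : |m| < 1 := by exact_mod_cast h1
    exact Int.abs_lt_one_iff.1 this
  have hn0 : n = 0 := by
    have : |n| < 1 := by exact_mod_cast hn
    exact Int.abs_lt_one_iff.1 this
  apply hz
  rw [hmn, hm0, hn0]; simp

lemma Mw0 {τ : ℂ} {t : ℝ} (ht : 0 < t) (hτ : τ = t * I) {η : ℂ} (hη : η ≠ 0)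
    (h1 : |η.im| < t/2) (h2 : |η.re| < 1/2) (x y : ℝ) :
    Mw τ η 0 (x + y*I) (x - y*I) = Complex.exp (cπ*I*τ) / (deriv (θf τ) 0 * θf τ (2*η)) *
      ((Ld τ (2*x + 1/2 + τ/2 + η) - Ld τ (2*x + 1/2 + τ/2 - η)) -
       (Ld τ (2*y*I + 1/2 + τ/2 + η) - Ld τ (2*y*I + 1/2 + τ/2 - η))) := by
  have hti : 0 < τ.im := by rw [hτ]; simpa using ht
  have hti' : τ.im = t := by rw [hτ]; simp
  have htr : τ.re = 0 := by rw [hτ]; simp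
  have b1 := abs_lt.1 h1
  have b2 := abs_lt.1 h2
  set a : ℂ := 2*x + 1/2 + τ/2 with ha
  set b : ℂ := 2*y*I + 1/2 + τ/2 with hb
  have ai : a.im = t/2 := by simp [ha, hti']
  have br : b.re = 1/2 := by simp [hb, htr]
  have na1 : θf τ (a + η) ≠ 0 := θ_ne_im ht hτ (by rw [add_im, ai]; linarith) (by rw [add_im, ai]; linarith)
  have na2 : θf τ (a - η) ≠ 0 := θ_ne_im ht hτ (by rw [sub_im, ai]; linarith) (by rw [sub_im, ai]; linarith)
  have nb1 : θf τ (b + η) ≠ 0 := θ_ne_re ht hτ (by rw [add_re, br]; linarith) (by rw [add_re, br]; linarith)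
  have nb2 : θf τ (b - η) ≠ 0 := θ_ne_re ht hτ (by rw [sub_re, br]; linarith) (by rw [sub_re, br]; linarith)
  have n0 : deriv (θf τ) 0 ≠ 0 := θ_simple hti (θ_zero τ)
  have n2 : θf τ (2*η) ≠ 0 := by
    refine θ_ne_small ht hτ (by simpa using hη) ?_ ?_
    · have : (2*η).re = 2*η.re := by simp
      rw [this, abs_mul, abs_two]; linarith
    · have : (2*η).im = 2*η.im := by simp
      rw [this, abs_mul, abs_two]; linarith
  have W := weier_deriv ht hτ η a b
  rw [show η + a = a + η by ring, show η + b = b + η by ring, show η - a = -(a - η) by ring,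
    show η - b = -(b - η) by ring, θ_neg, θ_neg, deriv_θ_neg, deriv_θ_neg] at W
  rw [Mw_eq]
  have eK : Kk τ η (0+2) (x + y*I) (x - y*I) = Complex.exp (4*cπ*I*(x + y*I)) *
      (θf τ (a - η) * θf τ (b - η) * (θf τ (a + η) * θf τ (b + η))) := by
    unfold Kk
    rw [Finset.prod_range_succ, Finset.prod_range_succ, Finset.prod_range_zero, one_mul]
    congr 1
    · congr 1; push_cast; ring
    · congr 2 <;> · congr 1; push_cast; ring
  have eu : θf τ (2*(x + y*I)) = Complex.exp (cπ*I*τ) * Complex.exp (4*cπ*I*(x + y*I)) * θf τ (a + b) := by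
    have : a + b = 2*(x + y*I) + τ + 1 := by rw [ha, hb]; ring
    rw [this, θ_add_one, θ_add_tau, neg_mul, neg_neg, ← mul_assoc, ← Complex.exp_add, ← Complex.exp_add,
      show cπ*I*τ + 4*cπ*I*(x + y*I) + (-cπ*I*τ - 2*cπ*I*(2*(x + y*I))) = 0 by ring, Complex.exp_zero,
      one_mul]
  have ew : θf τ (2*(x - y*I)) = θf τ (a - b) := by
    congr 1; rw [ha, hb]; ring
  rw [eK, eu, ew]
  unfold Ld
  have hE := Complex.exp_ne_zero (4*cπ*I*(x + y*I))
  rw [div_sub_div _ _ na1 na2, div_sub_div _ _ nb1 nb2,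
    div_sub_div _ _ (mul_ne_zero na1 na2) (mul_ne_zero nb1 nb2), div_mul_div_comm,
    div_eq_div_iff (by simp [hE, na1, na2, nb1, nb2]) (by simp [n0, n2, na1, na2, nb1, nb2])]
  linear_combination (-(Complex.exp (cπ*I*τ) * Complex.exp (4*cπ*I*(x + y*I)) *
    (θf τ (a - η) * θf τ (b - η) * (θf τ (a + η) * θf τ (b + η))))) * W

lemma intX {τ : ℂ} {t : ℝ} (ht : 0 < t) (hτ : τ = t * I) {η : ℂ} (h1 : |η.im| < t/2) :
    ∫ x in (0:ℝ)..(1:ℝ), Ld τ (2*x + 1/2 + τ/2 + η) = ∫ x in (0:ℝ)..(1:ℝ), Ld τ (2*x + 1/2 + τ/2) := by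
  have hti : 0 < τ.im := by rw [hτ]; simpa using ht
  have hti' : τ.im = t := by rw [hτ]; simp
  have b1 := abs_lt.1 h1
  have := shift1 (h := fun z : ℂ => Ld τ (2*z + 1/2 + τ/2)) (T := 1) (fun z => by
    rw [ofReal_one, show 2*(z+1) + 1/2 + τ/2 = 2*z + 1/2 + τ/2 + 1 + 1 by ring, Ld_add_one, Ld_add_one])
    (η/2) (fun z hz => by
      refine DifferentiableAt.comp z (g := Ld τ) (f := fun z : ℂ => 2*z + 1/2 + τ/2)
        (Ld_diff hti (θ_ne_im ht hτ ?_ ?_)) (by fun_prop)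
      all_goals
        have e : (2*z + 1/2 + τ/2).im = 2*z.im + t/2 := by simp [hti']
        have e2 : (η/2).im = η.im/2 := by simp
        rw [e2, Set.mem_uIcc] at hz
        rw [e]
        rcases hz with hz | hz <;> linarith)
  rw [← this]
  congr 1; funext x; congr 1; ring

lemma intY {τ : ℂ} {t : ℝ} (ht : 0 < t) (hτ : τ = t * I) {η : ℂ} (h2 : |η.re| < 1/2) :
    ∫ y in (0:ℝ)..t, (Ld τ (2*y*I + 1/2 + τ/2 + η) + 2*cπ*I/τ*(2*y*I + 1/2 + τ/2 + η)) =
    ∫ y in (0:ℝ)..t, (Ld τ (2*y*I + 1/2 + τ/2) + 2*cπ*I/τ*(2*y*I + 1/2 + τ/2)) := by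
  have hti : 0 < τ.im := by rw [hτ]; simpa using ht
  have htr : τ.re = 0 := by rw [hτ]; simp
  have hτ0 : τ ≠ 0 := by intro h; rw [h] at hti; simp at hti
  have b2 := abs_lt.1 h2
  -- use periodicity off the zeros; at zeros the junk value is also controlled
  have hz0 : ∀ z, θf τ z = 0 → θf τ (z + τ) = 0 := fun z hz => by rw [θ_add_tau, hz, mul_zero]
  let h : ℂ → ℂ := fun z => if θf τ (2*z*I + 1/2 + τ/2) = 0 then 0 else
    Ld τ (2*z*I + 1/2 + τ/2) + 2*cπ*I/τ*(2*z*I + 1/2 + τ/2)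
  have hne : ∀ z : ℂ, |z.im| ≤ |η.re|/2 → θf τ (2*z*I + 1/2 + τ/2) ≠ 0 := by
    intro z hz
    have c := abs_le.1 hz
    have e : (2*z*I + 1/2 + τ/2).re = 1/2 - 2*z.im := by simp [htr]; ring
    apply θ_ne_re ht hτ <;> rw [e] <;> linarith
  have hi : (-I*η/2).im = -(η.re/2) := by simp; ring
  have hmem : ∀ z : ℂ, z.im ∈ Set.uIcc 0 (-I*η/2).im → |z.im| ≤ |η.re|/2 := by
    intro z hz
    rw [hi, Set.mem_uIcc] at hz
    have p1 := le_abs_self η.re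
    have p2 := neg_abs_le η.re
    rw [abs_le]
    rcases hz with hz | hz <;> constructor <;> linarith
  have := shift1 (h := h) (T := t) (fun z => by
      have e : 2*(z+t)*I + 1/2 + τ/2 = 2*z*I + 1/2 + τ/2 + τ + τ := by rw [hτ]; ring
      simp only [h]
      rw [e]
      by_cases hz : θf τ (2*z*I + 1/2 + τ/2) = 0
      · rw [if_pos hz, if_pos (hz0 _ (hz0 _ hz))]
      · have hz1 : θf τ (2*z*I + 1/2 + τ/2 + τ) ≠ 0 := by
          rw [θ_add_tau]; exact mul_ne_zero (neg_ne_zero.2 (Complex.exp_ne_zero _)) hz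
        have hz2 : θf τ (2*z*I + 1/2 + τ/2 + τ + τ) ≠ 0 := by
          rw [θ_add_tau]; exact mul_ne_zero (neg_ne_zero.2 (Complex.exp_ne_zero _)) hz1
        rw [if_neg hz, if_neg hz2, Ld_add_tau hti hz1, Ld_add_tau hti hz]
        field_simp
        ring)
    (-I*η/2) (fun z hz => by
      have hn := hne z (hmem z hz)
      have hl : Differentiable ℂ fun z : ℂ => 2*z*I + 1/2 + τ/2 := by fun_prop
      have d1 : DifferentiableAt ℂ (fun z : ℂ => Ld τ (2*z*I + 1/2 + τ/2)) z :=
        DifferentiableAt.comp z (g := Ld τ) (f := fun z : ℂ => 2*z*I + 1/2 + τ/2)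
        (Ld_diff hti hn) (hl z)
      have d2 := d1.fun_add ((hl z).const_mul (2*cπ*I/τ))
      refine d2.congr_of_eventuallyEq ?_
      have hc : Continuous fun z : ℂ => θf τ (2*z*I + 1/2 + τ/2) :=
        (θ_cont hti).comp hl.continuous
      filter_upwards [hc.continuousAt.eventually_ne hn] with w hw
      simp only [h, if_neg hw])
  have e1 : ∀ y : ℝ, h (y + -I*η/2) = Ld τ (2*y*I + 1/2 + τ/2 + η) + 2*cπ*I/τ*(2*y*I + 1/2 + τ/2 + η) := by
    intro y
    have hn := hne (y + -I*η/2) (by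
      rw [add_im, hi, ofReal_im, zero_add, abs_neg, abs_div, abs_two])
    simp only [h, if_neg hn]
    rw [show 2*(y + -I*η/2)*I + 1/2 + τ/2 = 2*y*I + 1/2 + τ/2 + η by linear_combination -η * I_sq]
  have e2 : ∀ y : ℝ, h y = Ld τ (2*y*I + 1/2 + τ/2) + 2*cπ*I/τ*(2*y*I + 1/2 + τ/2) := by
    intro y
    have hn := hne y (by simp; positivity)
    simp only [h, if_neg hn]
  simp only [e1, e2] at this
  exact this

lemma base_case {τ : ℂ} {t : ℝ} (ht : 0 < t) (hτ : τ = t * I) {η : ℂ} (hη : η ≠ 0)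
    (h1 : |η.im| < t/2) (h2 : |η.re| < 1/2) :
    dint t (fun u w => Mw τ η 0 u w) = Cconst τ η 0 := by
  have hti : 0 < τ.im := by rw [hτ]; simpa using ht
  have hti' : τ.im = t := by rw [hτ]; simp
  have htr : τ.re = 0 := by rw [hτ]; simp
  have hτ0 : τ ≠ 0 := by intro h; rw [h] at hti; simp at hti
  have cX : ∀ ε : ℂ, |ε.im| < t/2 → Continuous fun x : ℝ => Ld τ (2*x + 1/2 + τ/2 + ε) := by
    intro ε hε
    have b := abs_lt.1 hε
    rw [continuous_iff_continuousAt]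
    intro x
    refine ContinuousAt.comp (g := Ld τ) (f := fun x : ℝ => (2*x + 1/2 + τ/2 + ε : ℂ))
      (Ld_diff hti (θ_ne_im ht hτ ?_ ?_)).continuousAt (by fun_prop)
    all_goals
      have e : (2*x + 1/2 + τ/2 + ε : ℂ).im = t/2 + ε.im := by simp [hti']
      rw [e]; linarith
  have cY : ∀ ε : ℂ, |ε.re| < 1/2 → Continuous fun y : ℝ => Ld τ (2*y*I + 1/2 + τ/2 + ε) := by
    intro ε hε
    have b := abs_lt.1 hε
    rw [continuous_iff_continuousAt]
    intro x
    refine ContinuousAt.comp (g := Ld τ) (f := fun x : ℝ => (2*x*I + 1/2 + τ/2 + ε : ℂ))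
      (Ld_diff hti (θ_ne_re ht hτ ?_ ?_)).continuousAt (by fun_prop)
    all_goals
      have e : (2*x*I + 1/2 + τ/2 + ε : ℂ).re = 1/2 + ε.re := by simp [htr]
      rw [e]; linarith
  have h1' : |(-η).im| < t/2 := by simpa using h1
  have h2' : |(-η).re| < 1/2 := by simpa using h2
  have iA : ∫ x in (0:ℝ)..(1:ℝ), (Ld τ (2*x + 1/2 + τ/2 + η) - Ld τ (2*x + 1/2 + τ/2 - η)) = 0 := by
    simp only [sub_eq_add_neg _ η]
    rw [intervalIntegral.integral_sub ((cX η h1).intervalIntegrable _ _)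
      ((cX (-η) h1').intervalIntegrable _ _), intX ht hτ h1, intX ht hτ h1', sub_self]
  have iB : ∫ y in (0:ℝ)..t, (Ld τ (2*y*I + 1/2 + τ/2 + η) - Ld τ (2*y*I + 1/2 + τ/2 - η)) =
      -4*cπ*η := by
    have c1 := cY η h2
    have c2 := cY (-η) h2'
    have e : ∀ y : ℝ, Ld τ (2*y*I + 1/2 + τ/2 + η) - Ld τ (2*y*I + 1/2 + τ/2 - η) =
      ((Ld τ (2*y*I + 1/2 + τ/2 + η) + 2*cπ*I/τ*(2*y*I + 1/2 + τ/2 + η)) -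
       (Ld τ (2*y*I + 1/2 + τ/2 + -η) + 2*cπ*I/τ*(2*y*I + 1/2 + τ/2 + -η))) - 4*cπ*I*η/τ := by
      intro y; rw [sub_eq_add_neg _ η]; ring
    simp only [e]
    have d1 : Continuous fun y : ℝ => Ld τ (2*y*I + 1/2 + τ/2 + η) + 2*cπ*I/τ*(2*y*I + 1/2 + τ/2 + η) :=
      c1.add (by fun_prop)
    have d2 : Continuous fun y : ℝ => Ld τ (2*y*I + 1/2 + τ/2 + -η) + 2*cπ*I/τ*(2*y*I + 1/2 + τ/2 + -η) :=
      c2.add (by fun_prop)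
    have d3 := d1.fun_sub d2
    rw [intervalIntegral.integral_sub (d3.intervalIntegrable _ _) (continuous_const.intervalIntegrable _ _),
      intervalIntegral.integral_sub (d1.intervalIntegrable _ _) (d2.intervalIntegrable _ _),
      intY ht hτ h2, intY ht hτ h2', sub_self, intervalIntegral.integral_const, hτ, real_smul]
    have : (t:ℂ) ≠ 0 := by exact_mod_cast ht.ne'
    push_cast
    field_simp
    ring
  unfold dint
  simp only [Mw0 ht hτ hη h1 h2]
  have inner : ∀ y : ℝ, ∫ x in (0:ℝ)..(1:ℝ), Complex.exp (cπ*I*τ) / (deriv (θf τ) 0 * θf τ (2*η)) *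
      ((Ld τ (2*x + 1/2 + τ/2 + η) - Ld τ (2*x + 1/2 + τ/2 - η)) -
       (Ld τ (2*y*I + 1/2 + τ/2 + η) - Ld τ (2*y*I + 1/2 + τ/2 - η))) =
      -(Complex.exp (cπ*I*τ) / (deriv (θf τ) 0 * θf τ (2*η))) *
       (Ld τ (2*y*I + 1/2 + τ/2 + η) - Ld τ (2*y*I + 1/2 + τ/2 - η)) := by
    intro y
    have c1 := (cX η h1).fun_sub (cX (-η) h1')
    simp only [← sub_eq_add_neg] at c1
    rw [intervalIntegral.integral_const_mul, intervalIntegral.integral_sub (c1.intervalIntegrable _ _)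
      (continuous_const.intervalIntegrable _ _), iA, intervalIntegral.integral_const]
    simp
    ring
  simp only [inner]
  rw [intervalIntegral.integral_const_mul, iB, (θ_deriv0 hti).deriv]
  unfold Cconst
  have hc : cπ ≠ 0 := by unfold cπ; exact_mod_cast Real.pi_ne_zero
  have hE : Complex.exp (cπ*I*τ) = Complex.exp (2*cπ*I*τ*(3/8)) * Complex.exp (cπ*I*(τ/4)) := by
    rw [← Complex.exp_add]; congr 1; ring
  have hq : qPoch (Complex.exp (2*cπ*I*τ)) (Complex.exp (2*cπ*I*τ)) ≠ 0 := by
    apply qPochqq_ne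
    exact norm_q hti
  have n2 : θf τ (2*η) ≠ 0 := by
    refine θ_ne_small ht hτ (by simpa using hη) ?_ ?_
    · have : (2*η).re = 2*η.re := by simp
      rw [this, abs_mul, abs_two]; linarith
    · have : (2*η).im = 2*η.im := by simp
      rw [this, abs_mul, abs_two]; linarith
  have hx := Complex.exp_ne_zero (cπ*I*(τ/4))
  rw [hE, Nat.cast_zero, zero_add, mul_one]
  field_simp
  norm_num

/-! ### Part H: induction -/

lemma θ_ne_mul {τ : ℂ} {t : ℝ} (ht : 0 < t) (hτ : τ = t * I) {η : ℂ} (hη : η ≠ 0) (m : ℕ)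
    (h1 : ((m:ℝ)+1) * |η.im| < t/2) (h2 : ((m:ℝ)+1) * |η.re| < 1/2) :
    θf τ (2*((m:ℂ)+1)*η) ≠ 0 := by
  have hm : ((m:ℂ)+1) ≠ 0 := by exact_mod_cast Nat.succ_ne_zero m
  have e0 : (2*((m:ℂ)+1)*η) = ((2*((m:ℝ)+1) : ℝ) : ℂ) * η := by push_cast; ring
  have p : (0:ℝ) ≤ 2*((m:ℝ)+1) := by positivity
  refine θ_ne_small ht hτ (mul_ne_zero (mul_ne_zero two_ne_zero hm) hη) ?_ ?_
  · rw [e0, re_ofReal_mul, abs_mul, abs_of_nonneg p]; linarith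
  · rw [e0, im_ofReal_mul, abs_mul, abs_of_nonneg p]; linarith

lemma cont_T {τ : ℂ} {t : ℝ} (ht : 0 < t) (hτ : τ = t * I) (η : ℂ) (N : ℕ)
    (h1 : ((N:ℝ)+1) * |η.im| < t/2) (h2 : ((N:ℝ)+1) * |η.re| < 1/2)
    {f : ℂ → ℂ} (hf : Continuous f) :
    Continuous fun v => dint t (fun u w => f u * Kk τ η N w v * Mw τ η N u w) := by
  have hti : 0 < τ.im := by rw [hτ]; simpa using ht
  have hK := (Kk_diff2 hti η N).continuous
  have hK2 := (Kk_diff2 hti η (N+2)).continuous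
  have hθ := θ_cont hti
  have c : Continuous fun p : (ℂ × ℝ) × ℝ =>
      f (p.2 + p.1.2*I) * Kk τ η N (p.2 - p.1.2*I) p.1.1 * Mw τ η N (p.2 + p.1.2*I) (p.2 - p.1.2*I) := by
    simp only [Mw_eq]
    have a1 : Continuous fun p : (ℂ × ℝ) × ℝ => (p.2 + p.1.2*I : ℂ) := by fun_prop
    have a2 : Continuous fun p : (ℂ × ℝ) × ℝ => (p.2 - p.1.2*I : ℂ) := by fun_prop
    have b1 : Continuous fun p : (ℂ × ℝ) × ℝ => Kk τ η N (p.2 - p.1.2*I) p.1.1 :=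
      Continuous.comp (g := fun p : ℂ × ℂ => Kk τ η N p.1 p.2)
        (f := fun p : (ℂ × ℝ) × ℝ => ((p.2 - p.1.2*I : ℂ), p.1.1)) hK
        (a2.prodMk (by fun_prop : Continuous fun p : (ℂ × ℝ) × ℝ => p.1.1))
    have b2 : Continuous fun p : (ℂ × ℝ) × ℝ => Kk τ η (N+2) (p.2 + p.1.2*I) (p.2 - p.1.2*I) :=
      Continuous.comp (g := fun p : ℂ × ℂ => Kk τ η (N+2) p.1 p.2)
        (f := fun p : (ℂ × ℝ) × ℝ => ((p.2 + p.1.2*I : ℂ), (p.2 - p.1.2*I : ℂ))) hK2 (a1.prodMk a2)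
    refine ((hf.comp a1).mul b1).mul (((hθ.comp (continuous_const.mul a1)).mul
      (hθ.comp (continuous_const.mul a2))).div b2 fun p => ?_)
    refine Kk_ne ht hτ η (N+1) _ _ ?_ ?_
    · have e : ((p.2 + p.1.2*I : ℂ) + (p.2 - p.1.2*I)).im = 0 := by simp
      rw [e]; push_cast; simpa using h1
    · have e : ((p.2 + p.1.2*I : ℂ) - (p.2 - p.1.2*I)).re = 0 := by simp
      rw [e]; push_cast; simpa using h2
  have d1 := intervalIntegral.continuous_parametric_intervalIntegral_of_continuous' (μ := volume)
    (f := fun (q : ℂ × ℝ) (x : ℝ) => f (x + q.2*I) * Kk τ η N (x - q.2*I) q.1 *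
      Mw τ η N (x + q.2*I) (x - q.2*I)) c 0 1
  have d2 := intervalIntegral.continuous_parametric_intervalIntegral_of_continuous' (μ := volume)
    (f := fun (v : ℂ) (y : ℝ) => ∫ x in (0:ℝ)..(1:ℝ), f (x + y*I) * Kk τ η N (x - y*I) v *
      Mw τ η N (x + y*I) (x - y*I)) d1 0 t
  exact d2

lemma Cconst_rec (τ η : ℂ) (n : ℕ) (h1 : θf τ (2*((n:ℂ)+1)*η) ≠ 0) :
    θf τ (2*((n:ℂ)+2)*η) ≠ 0 →
    θf τ (2*((n:ℂ)+2)*η) * Cconst τ η (n+1) = Cconst τ η n * θf τ (2*((n:ℂ)+1)*η) := by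
  intro h2
  unfold Cconst
  rw [show 2*(((n+1:ℕ):ℂ)+1)*η = 2*((n:ℂ)+2)*η by push_cast; ring]
  generalize qPoch _ _ ^ 3 = Q
  rw [mul_comm _ Q, mul_comm _ Q, ← div_div, ← div_div, mul_div_cancel₀ _ h2, div_mul_cancel₀ _ h1]

lemma main_ind {τ : ℂ} {t : ℝ} (ht : 0 < t) (hτ : τ = t * I) {η : ℂ} (hη : η ≠ 0) (N : ℕ) :
    ((N:ℝ)+1) * |η.im| < t/2 → ((N:ℝ)+1) * |η.re| < 1/2 →
    ∀ (f : ℂ → ℂ), ThetaSp τ N f → ∀ v : ℂ,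
    dint t (fun u w => f u * Kk τ η N w v * Mw τ η N u w) = Cconst τ η N * f v := by
  have hti : 0 < τ.im := by rw [hτ]; simpa using ht
  induction N with
  | zero =>
    intro h1 h2 f hf v
    simp only [Nat.cast_zero, zero_add, one_mul] at h1 h2
    have hc : ∀ x, f x = f v := fun x => liouville ht hτ hf.1 (by simpa using hf.quasi) x v
    have e : dint t (fun u w => f u * Kk τ η 0 w v * Mw τ η 0 u w) =
        dint t (fun u w => f v * Mw τ η 0 u w) := by
      apply dint_congr
      intro x y
      rw [hc]; simp [Kk]
    rw [e, dint_smul, base_case ht hτ hη h1 h2, mul_comm]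
  | succ n ih =>
    intro h1 h2 f hf v
    have p1 : ((n:ℝ)+1) * |η.im| < t/2 := by
      push_cast at h1; have := abs_nonneg η.im; nlinarith
    have p2 : ((n:ℝ)+1) * |η.re| < 1/2 := by
      push_cast at h2; have := abs_nonneg η.re; nlinarith
    have q1 : ((n:ℝ)+2) * |η.im| < t/2 := by
      push_cast at h1; linarith
    have q2 : ((n:ℝ)+2) * |η.re| < 1/2 := by
      push_cast at h2; linarith
    have n1 := θ_ne_mul ht hτ hη n p1 p2
    have n2 := θ_ne_mul ht hτ hη (n+1) h1 h2
    rw [show 2*(((n+1:ℕ):ℂ)+1)*η = 2*((n:ℂ)+2)*η by push_cast; ring] at n2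
    refine ext_simp (simp_θ hti 2 (-2*η) two_ne_zero) (cont_T ht hτ η (n+1) h1 h2 hf.1.continuous)
      (continuous_const.mul hf.1.continuous) ?_ v
    intro v hv
    have hv' : θf τ (2*v - 2*η) ≠ 0 := by
      rw [show 2*v - 2*η = 2*v + -2*η by ring]; exact hv
    obtain ⟨D, hD, hDe⟩ := D_exists hti η (v + n*η) n hf
    have B := bil ht hτ η (v + n*η) n q1 q2 hf (thetaSp_Kk hti η n (v - η)) hDe
    simp only [← Kk_succ_w] at B
    rw [ih p1 p2 D hD (v - η), D_special η v n hf.2.2.2 hDe hv'] at B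
    apply mul_left_cancel₀ n2
    simp only [Pi.mul_apply]
    linear_combination B - f v * Cconst_rec τ η n n1 n2

/-- For η ∈ (ℝ_N ∪ 𝕀_N), η ≠ 0, C⁻¹K_v is the reproducing kernel of Θ_N
for the Sklyanin pairing: ⟨f, K_v⟩ = C·f(v) for f ∈ Θ_N, v ∈ ℂ. -/
theorem sklyanin_reproducing_kernel
    (t : ℝ) (ht : 0 < t) (τ : ℂ) (hτ : τ = t * I)
    (N : ℕ) (η : ℂ)
    (hη : (∃ r : ℝ, η = (r : ℂ) ∧ |r| < 1 / (2 * (N + 1))) ∨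
          (∃ s : ℝ, η = (s : ℂ) * I ∧ |s| < t / (2 * (N + 1))))
    (hη0 : η ≠ 0)
    (f : ℂ → ℂ) (hf : ThetaSp τ N f) (v : ℂ) :
    pairing τ η t N f (fun u => Kk τ η N u ((starRingEnd ℂ) v)) =
      Cconst τ η N * f v := by
  have hN : (0:ℝ) < 2 * ((N:ℝ) + 1) := by positivity
  have hc : ((N:ℝ)+1) * |η.im| < t/2 ∧ ((N:ℝ)+1) * |η.re| < 1/2 ∧
      ((starRingEnd ℂ) η = η ∨ (starRingEnd ℂ) η = -η) := by
    rcases hη with ⟨r, rfl, hr⟩ | ⟨s, rfl, hs⟩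
    · rw [lt_div_iff₀ hN] at hr
      refine ⟨?_, ?_, Or.inl (Complex.conj_ofReal r)⟩
      · simpa using ht
      · rw [ofReal_re]; linarith
    · rw [lt_div_iff₀ hN] at hs
      refine ⟨?_, ?_, Or.inr ?_⟩
      · have e : ((s:ℂ) * I).im = s := by simp
        rw [e]; linarith
      · simp
      · simp
  have key := main_ind ht hτ hη0 N hc.1 hc.2.1 f hf v
  rw [← key]
  unfold pairing dint
  have hconj : ∀ x y : ℝ, (starRingEnd ℂ) ((x:ℂ) + y*I) = x - y*I := by
    intro x y
    simp [sub_eq_add_neg]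
  simp only [Kk_conj hτ hc.2.2, hconj]
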